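/- For every set S of N points in the plane in general position, ĥv_x(S) ≥ N/3207.42. -/

import Mathlib

open scoped Classical

noncomputable section

/-- A point in the plane. -/
abbrev Pt : Type := ℝ × ℝ

/-- `S` is in general position: no three distinct points of `S` are collinear. -/
def GenPos (S : Finset Pt) : Prop :=
  ∀ p ∈ S, ∀ q ∈ S, ∀ r ∈ S, p ≠ q → p ≠ r → q ≠ r →
    ¬ Collinear ℝ ({p, q, r} : Set Pt)

/-- Two straight edges cross if their relative interiors (open segments) meet. -/
def EdgesCross (e f : Sym2 Pt) : Prop :=
  ∃ a b c d : Pt, e = s(a, b) ∧ f = s(c, d) ∧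
    (openSegment ℝ a b ∩ openSegment ℝ c d).Nonempty

/-- `G` is a crossing-free straight-edge (plane) graph on the point set `S`:
its edges are nondegenerate straight segments between points of `S`,
and no two distinct edges cross. -/
def IsPlaneGraph (S : Finset Pt) (G : Finset (Sym2 Pt)) : Prop :=
  (∀ e ∈ G, ¬ e.IsDiag ∧ ∀ p ∈ e, p ∈ S) ∧
    ∀ e ∈ G, ∀ f ∈ G, e ≠ f → ¬ EdgesCross e f

/-- The (finite) collection of all plane graphs on `S`. -/
def planeGraphs (S : Finset Pt) : Finset (Finset (Sym2 Pt)) :=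
  S.sym2.powerset.filter (IsPlaneGraph S)

/-- The degree of the point `p` in the graph `G`. -/
def vingDeg (G : Finset (Sym2 Pt)) (p : Pt) : ℕ :=
  (G.filter fun e => p ∈ e).card

/-- The ving `(p, G)` is an x-ving: no straight edge from `p` to another point
of `S` can be added to `G` while keeping the graph plane. -/
def IsXVing (S : Finset Pt) (G : Finset (Sym2 Pt)) (p : Pt) : Prop :=
  ∀ q ∈ S, q ≠ p → s(p, q) ∉ G → ¬ IsPlaneGraph S (insert s(p, q) G)

/-- `v_x(G)`: the number of x-vings of `G`. -/
def vx (S : Finset Pt) (G : Finset (Sym2 Pt)) : ℕ :=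
  (S.filter (IsXVing S G)).card

/-- `v_i(G)`: the number of vertices of degree exactly `i` in `G`. -/
def vdeg (S : Finset Pt) (G : Finset (Sym2 Pt)) (i : ℕ) : ℕ :=
  (S.filter fun p => vingDeg G p = i).card

/-- `ĥv_x(S)`: the average of `v_x(G)` over a uniformly random plane graph on `S`. -/
def hvx (S : Finset Pt) : ℝ :=
  (∑ G ∈ planeGraphs S, (vx S G : ℝ)) / (planeGraphs S).card

/-- `ĥv_i(S)`: the average of `v_i(G)` over a uniformly random plane graph on `S`. -/
def hvdeg (S : Finset Pt) (i : ℕ) : ℝ :=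
  (∑ G ∈ planeGraphs S, (vdeg S G i : ℝ)) / (planeGraphs S).card

/-- `pg(N)`: the maximum number of plane graphs over all sets of `N` points in
general position. -/
def pgMax (N : ℕ) : ℕ :=
  sSup {n : ℕ | ∃ S : Finset Pt, S.card = N ∧ GenPos S ∧ (planeGraphs S).card = n}

/-- The plane graphs on `S` with at most `m` edges. -/
def planeGraphsLE (S : Finset Pt) (m : ℝ) : Finset (Finset (Sym2 Pt)) :=
  (planeGraphs S).filter fun G => (G.card : ℝ) ≤ m

/-- `ĥv_{x,m}(S)`: the average of `v_x(G)` over a uniformly random plane graph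
on `S` with at most `m` edges. -/
def hvxLE (S : Finset Pt) (m : ℝ) : ℝ :=
  (∑ G ∈ planeGraphsLE S m, (vx S G : ℝ)) / (planeGraphsLE S m).card

/-- `G` has no vertex (point of `S`) of degree smaller than `i`. -/
def MinDegGe (S : Finset Pt) (G : Finset (Sym2 Pt)) (i : ℕ) : Prop :=
  ∀ p ∈ S, i ≤ vingDeg G p

/-- The plane graphs on `S` with no vertex of degree smaller than `i`. -/
def planeGraphsDeg (S : Finset Pt) (i : ℕ) : Finset (Finset (Sym2 Pt)) :=
  (planeGraphs S).filter fun G => MinDegGe S G i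

/-- The plane graphs on `S` with at most `m` edges and no vertex of degree
smaller than `i`. -/
def planeGraphsLEDeg (S : Finset Pt) (m : ℝ) (i : ℕ) : Finset (Finset (Sym2 Pt)) :=
  (planeGraphs S).filter fun G => (G.card : ℝ) ≤ m ∧ MinDegGe S G i

/-- `ĥv_{x,m}(S,i)`: the average of `v_x(G)` over a uniformly random plane graph
on `S` with at most `m` edges and no vertex of degree smaller than `i`. -/
def hvxLEDeg (S : Finset Pt) (m : ℝ) (i : ℕ) : ℝ :=
  (∑ G ∈ planeGraphsLEDeg S m i, (vx S G : ℝ)) / (planeGraphsLEDeg S m i).card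

/-- `pg(N, i)`: the maximum, over sets `S` of `N` points in general position, of
the number of plane graphs on `S` with no vertex of degree smaller than `i`. -/
def pgMaxDeg (N i : ℕ) : ℕ :=
  sSup {n : ℕ | ∃ S : Finset Pt, S.card = N ∧ GenPos S ∧ (planeGraphsDeg S i).card = n}

/-- The underlying abstract graph of `G` on the vertex set `S`. -/
def abstractGraph (S : Finset Pt) (G : Finset (Sym2 Pt)) :
    SimpleGraph (S : Set Pt) :=
  SimpleGraph.induce (S : Set Pt) (SimpleGraph.fromEdgeSet (G : Set (Sym2 Pt)))

/-- The connected plane graphs on `S`. -/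
def connPlaneGraphs (S : Finset Pt) : Finset (Finset (Sym2 Pt)) :=
  (planeGraphs S).filter fun G => (abstractGraph S G).Connected

/-- The underlying abstract graph of `G` is bi-connected (2-vertex-connected):
it is connected and remains connected after deletion of any single vertex. -/
def Biconnected (S : Finset Pt) (G : Finset (Sym2 Pt)) : Prop :=
  (abstractGraph S G).Connected ∧
    ∀ v ∈ S, (SimpleGraph.induce ((S : Set Pt) \ {v})
      (SimpleGraph.fromEdgeSet (G : Set (Sym2 Pt)))).Connected

/-- The bi-connected plane graphs on `S`. -/
def biconnPlaneGraphs (S : Finset Pt) : Finset (Finset (Sym2 Pt)) :=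
  (planeGraphs S).filter (Biconnected S)

/-- `G` is a `k`-quasi-plane graph on `S`: a straight-edge graph on `S`
(crossings allowed) with no `k` pairwise crossing edges. -/
def IsQuasiPlane (k : ℕ) (S : Finset Pt) (G : Finset (Sym2 Pt)) : Prop :=
  (∀ e ∈ G, ¬ e.IsDiag ∧ ∀ p ∈ e, p ∈ S) ∧
    ¬ ∃ T ⊆ G, T.card = k ∧ ∀ e ∈ T, ∀ f ∈ T, e ≠ f → EdgesCross e f

/-- The (finite) collection of all `k`-quasi-plane graphs on `S`. -/
def qpGraphs (k : ℕ) (S : Finset Pt) : Finset (Finset (Sym2 Pt)) :=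
  S.sym2.powerset.filter (IsQuasiPlane k S)

/-- The ving `(p, G)` is an x-ving of the `k`-quasi-plane graph `G`: no straight
edge from `p` to another point of `S` can be added to `G` without violating
`k`-quasi-planarity. -/
def IsXVingQP (k : ℕ) (S : Finset Pt) (G : Finset (Sym2 Pt)) (p : Pt) : Prop :=
  ∀ q ∈ S, q ≠ p → s(p, q) ∉ G → ¬ IsQuasiPlane k S (insert s(p, q) G)

/-- `v_x(G)` for a `k`-quasi-plane graph `G`. -/
def vxQP (k : ℕ) (S : Finset Pt) (G : Finset (Sym2 Pt)) : ℕ :=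
  (S.filter (IsXVingQP k S G)).card

/-- `ĥv_x^k(S)`: the average of `v_x(G)` over a uniformly random `k`-quasi-plane
graph on `S`. -/
def hvxQP (k : ℕ) (S : Finset Pt) : ℝ :=
  (∑ G ∈ qpGraphs k S, (vxQP k S G : ℝ)) / (qpGraphs k S).card

/-- `qp_k(N)`: the maximum number of `k`-quasi-plane graphs over all sets of `N`
points in general position. -/
def qpMax (k N : ℕ) : ℕ :=
  sSup {n : ℕ | ∃ S : Finset Pt, S.card = N ∧ GenPos S ∧ (qpGraphs k S).card = n}

/-- Twice the signed area of the triangle `a b c`. -/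
def orient (a b c : Pt) : ℝ :=
  (b.1 - a.1) * (c.2 - a.2) - (b.2 - a.2) * (c.1 - a.1)

lemma orient_rotate (a b c : Pt) : orient a b c = orient b c a := by
  simp only [orient]; ring

lemma orient_swap (a b c : Pt) : orient a b c = - orient b a c := by
  simp only [orient]; ring

lemma orient_swap_right (a b c : Pt) : orient a b c = - orient a c b := by
  simp only [orient]; ring

@[simp] lemma orient_self_left (a b : Pt) : orient a a b = 0 := by
  simp only [orient]; ring

@[simp] lemma orient_self_right (a b : Pt) : orient a b b = 0 := by
  simp only [orient]; ring

@[simp] lemma orient_self_outer (a b : Pt) : orient a b a = 0 := by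
  simp only [orient]; ring

lemma mem_openSegment_iff_coord {v a b : Pt} :
    v ∈ openSegment ℝ a b ↔ ∃ s : ℝ, 0 < s ∧ s < 1 ∧
      v.1 = a.1 + s * (b.1 - a.1) ∧ v.2 = a.2 + s * (b.2 - a.2) := by
  rw [openSegment_eq_image']
  constructor
  · rintro ⟨s, ⟨h0, h1⟩, rfl⟩
    exact ⟨s, h0, h1, by simp, by simp⟩
  · rintro ⟨s, h0, h1, hx, hy⟩
    exact ⟨s, ⟨h0, h1⟩, by ext <;> simp [hx, hy]⟩

lemma collinear_of_orient_eq_zero {a b c : Pt} (hab : a ≠ b) (h : orient a b c = 0) :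
    Collinear ℝ ({a, b, c} : Set Pt) := by
  rw [collinear_iff_of_mem (p₀ := a) (by simp)]
  refine ⟨b - a, ?_⟩
  have key : ∃ t : ℝ, c = t • (b - a) + a := by
    by_cases h1 : b.1 - a.1 = 0
    · have h2 : b.2 - a.2 ≠ 0 := by
        intro h2
        exact hab (Prod.ext (by linarith) (by linarith))
      refine ⟨(c.2 - a.2) / (b.2 - a.2), ?_⟩
      simp only [orient, h1, zero_mul, zero_sub, neg_eq_zero, mul_eq_zero] at h
      ext
      · simp only [Prod.fst_add, Prod.smul_fst, Prod.fst_sub, h1, smul_zero, zero_add]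
        rcases h with h | h
        · exact absurd h h2
        · linarith
      · simp only [Prod.snd_add, Prod.smul_snd, Prod.snd_sub, smul_eq_mul]
        field_simp
        ring
    · refine ⟨(c.1 - a.1) / (b.1 - a.1), ?_⟩
      simp only [orient] at h
      ext
      · simp only [Prod.fst_add, Prod.smul_fst, Prod.fst_sub, smul_eq_mul]
        field_simp
        ring
      · simp only [Prod.snd_add, Prod.smul_snd, Prod.snd_sub, smul_eq_mul]
        field_simp
        linarith
  intro p hp
  simp only [Set.mem_insert_iff, Set.mem_singleton_iff] at hp
  rcases hp with rfl | rfl | rfl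
  · exact ⟨0, by simp⟩
  · exact ⟨1, by simp⟩
  · simpa using key

lemma GenPos.orient_ne_zero {S : Finset Pt} (hS : GenPos S) {a b c : Pt}
    (ha : a ∈ S) (hb : b ∈ S) (hc : c ∈ S) (hab : a ≠ b) (hac : a ≠ c) (hbc : b ≠ c) :
    orient a b c ≠ 0 :=
  fun h => hS a ha b hb c hc hab hac hbc (collinear_of_orient_eq_zero hab h)

/-- The segments `a b` and `c d` cross transversally. -/
def SegCross (a b c d : Pt) : Prop :=
  orient a b c * orient a b d < 0 ∧ orient c d a * orient c d b < 0

lemma SegCross.symm {a b c d : Pt} (h : SegCross a b c d) : SegCross c d a b := ⟨h.2, h.1⟩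

lemma SegCross.swap_right {a b c d : Pt} (h : SegCross a b c d) : SegCross a b d c := by
  refine ⟨by linarith [h.1, mul_comm (orient a b c) (orient a b d)], ?_⟩
  rw [orient_swap d c a, orient_swap d c b]
  linarith [h.2]

lemma edgesCross_iff {a b c d : Pt} :
    EdgesCross s(a, b) s(c, d) ↔ ∃ v, v ∈ openSegment ℝ a b ∧ v ∈ openSegment ℝ c d := by
  constructor
  · rintro ⟨a', b', c', d', h1, h2, v, hv1, hv2⟩
    refine ⟨v, ?_, ?_⟩
    · rcases Sym2.eq_iff.1 h1 with ⟨rfl, rfl⟩ | ⟨rfl, rfl⟩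
      · exact hv1
      · rwa [openSegment_symm]
    · rcases Sym2.eq_iff.1 h2 with ⟨rfl, rfl⟩ | ⟨rfl, rfl⟩
      · exact hv2
      · rwa [openSegment_symm]
  · rintro ⟨v, h1, h2⟩
    exact ⟨a, b, c, d, rfl, rfl, v, h1, h2⟩

lemma orient_of_mem_openSegment {v a b : Pt} (hv : v ∈ openSegment ℝ a b) :
    orient a b v = 0 := by
  obtain ⟨s, -, -, h1, h2⟩ := mem_openSegment_iff_coord.1 hv
  simp only [orient, h1, h2]; ring

lemma exists_affine_of_mem_openSegment {v c d : Pt} (hv : v ∈ openSegment ℝ c d) :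
    ∃ s : ℝ, 0 < s ∧ s < 1 ∧
      ∀ a b, orient a b v = (1 - s) * orient a b c + s * orient a b d := by
  obtain ⟨s, h0, h1, hx, hy⟩ := mem_openSegment_iff_coord.1 hv
  refine ⟨s, h0, h1, fun a b => ?_⟩
  simp only [orient, hx, hy]; ring

lemma SegCross.exists_mem {a b c d : Pt} (h : SegCross a b c d) :
    ∃ v, v ∈ openSegment ℝ a b ∧ v ∈ openSegment ℝ c d := by
  obtain ⟨h1, h2⟩ := h
  have hD : orient c d a - orient c d b ≠ 0 := by
    intro h0
    have : orient c d a = orient c d b := by linarith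
    rw [this] at h2
    nlinarith [mul_self_nonneg (orient c d b)]
  have hE : orient a b c - orient a b d ≠ 0 := by
    intro h0
    have : orient a b c = orient a b d := by linarith
    rw [this] at h1
    nlinarith [mul_self_nonneg (orient a b d)]
  have ratio : ∀ x y : ℝ, x * y < 0 → 0 < x / (x - y) ∧ x / (x - y) < 1 := by
    intro x y hxy
    rcases mul_neg_iff.1 hxy with ⟨hx, hy⟩ | ⟨hx, hy⟩
    · have : 0 < x - y := by linarith
      exact ⟨by positivity, by rw [div_lt_one this]; linarith⟩
    · have : 0 < y - x := by linarith
      have e : x / (x - y) = (-x) / (y - x) := by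
        rw [← neg_sub y x, div_neg, neg_div]
      rw [e]
      exact ⟨div_pos (by linarith) this, by rw [div_lt_one this]; linarith⟩
  set t := orient c d a / (orient c d a - orient c d b) with ht
  set s := orient a b c / (orient a b c - orient a b d) with hs
  have e : orient c d a - orient c d b = -(orient a b c - orient a b d) := by
    simp only [orient]; ring
  have key1 : a.1 + t * (b.1 - a.1) = c.1 + s * (d.1 - c.1) := by
    rw [ht, hs, e]
    field_simp
    simp only [orient]; ring
  have key2 : a.2 + t * (b.2 - a.2) = c.2 + s * (d.2 - c.2) := by
    rw [ht, hs, e]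
    field_simp
    simp only [orient]; ring
  obtain ⟨t0, t1⟩ := ratio _ _ h2
  obtain ⟨s0, s1⟩ := ratio _ _ h1
  exact ⟨(a.1 + t * (b.1 - a.1), a.2 + t * (b.2 - a.2)),
    mem_openSegment_iff_coord.2 ⟨t, t0, t1, rfl, rfl⟩,
    mem_openSegment_iff_coord.2 ⟨s, s0, s1, key1, key2⟩⟩

lemma mul_neg_of_convex_zero {x y s : ℝ} (h0 : 0 < s) (h1 : s < 1) (hx : x ≠ 0)
    (h : 0 = (1 - s) * x + s * y) : x * y < 0 := by
  have hx2 : 0 < x * x := mul_self_pos.2 hx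
  have h3 : s * (x * y) = - ((1 - s) * (x * x)) := by linear_combination (-x) * h
  have h4 : 0 < (1 - s) * (x * x) := mul_pos (by linarith) hx2
  by_contra hcon
  have : 0 ≤ s * (x * y) := mul_nonneg h0.le (not_lt.1 hcon)
  linarith

lemma GenPos.segCross_half {S : Finset Pt} (hS : GenPos S) {a b c d v : Pt}
    (ha : a ∈ S) (hb : b ∈ S) (hc : c ∈ S) (hd : d ∈ S) (hab : a ≠ b) (hcd : c ≠ d)
    (hne : s(a, b) ≠ s(c, d)) (hv1 : v ∈ openSegment ℝ a b) (hv2 : v ∈ openSegment ℝ c d) :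
    orient a b c * orient a b d < 0 := by
  obtain ⟨s, h0, h1, hs⟩ := exists_affine_of_mem_openSegment hv2
  have h := hs a b
  rw [orient_of_mem_openSegment hv1] at h
  by_cases hc0 : orient a b c = 0
  · exfalso
    have hd0 : orient a b d = 0 := by
      rw [hc0, mul_zero, zero_add] at h
      exact (mul_eq_zero.1 h.symm).resolve_left h0.ne'
    have hc' : c = a ∨ c = b := by
      by_contra hcon
      push Not at hcon
      exact hS.orient_ne_zero ha hb hc hab hcon.1.symm hcon.2.symm hc0
    have hd' : d = a ∨ d = b := by
      by_contra hcon
      push Not at hcon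
      exact hS.orient_ne_zero ha hb hd hab hcon.1.symm hcon.2.symm hd0
    rcases hc' with rfl | rfl <;> rcases hd' with rfl | rfl
    · exact hcd rfl
    · exact hne rfl
    · exact hne Sym2.eq_swap
    · exact hcd rfl
  · exact mul_neg_of_convex_zero h0 h1 hc0 h

lemma GenPos.edgesCross_iff_segCross {S : Finset Pt} (hS : GenPos S) {a b c d : Pt}
    (ha : a ∈ S) (hb : b ∈ S) (hc : c ∈ S) (hd : d ∈ S) (hab : a ≠ b) (hcd : c ≠ d)
    (hne : s(a, b) ≠ s(c, d)) :
    EdgesCross s(a, b) s(c, d) ↔ SegCross a b c d := by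
  rw [edgesCross_iff]
  constructor
  · rintro ⟨v, h1, h2⟩
    exact ⟨hS.segCross_half ha hb hc hd hab hcd hne h1 h2,
      hS.segCross_half hc hd ha hb hcd hab hne.symm h2 h1⟩
  · exact SegCross.exists_mem

/-- A plane graph on `S` to which no edge can be added. -/
structure IsTriangulation (S : Finset Pt) (T : Finset (Sym2 Pt)) : Prop where
  plane : IsPlaneGraph S T
  maximal : ∀ p ∈ S, ∀ q ∈ S, p ≠ q → s(p, q) ∉ T → ¬ IsPlaneGraph S (insert s(p, q) T)

lemma IsPlaneGraph.mono {S : Finset Pt} {G H : Finset (Sym2 Pt)} (hH : IsPlaneGraph S H)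
    (h : G ⊆ H) : IsPlaneGraph S G :=
  ⟨fun e he => hH.1 e (h he), fun e he f hf => hH.2 e (h he) f (h hf)⟩

lemma EdgesCross.symm {e f : Sym2 Pt} (h : EdgesCross e f) : EdgesCross f e := by
  obtain ⟨a, b, c, d, h1, h2, h3⟩ := h
  exact ⟨c, d, a, b, h2, h1, by rwa [Set.inter_comm]⟩

lemma IsPlaneGraph.insert {S : Finset Pt} {G : Finset (Sym2 Pt)} (hG : IsPlaneGraph S G)
    {p q : Pt} (hp : p ∈ S) (hq : q ∈ S) (hpq : p ≠ q)
    (h : ∀ f ∈ G, s(p, q) ≠ f → ¬ EdgesCross s(p, q) f) :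
    IsPlaneGraph S (insert s(p, q) G) := by
  refine ⟨fun e he => ?_, fun e he f hf hef => ?_⟩
  · rcases Finset.mem_insert.1 he with rfl | he
    · refine ⟨by simpa using hpq, fun r hr => ?_⟩
      rcases Sym2.mem_iff.1 hr with rfl | rfl <;> assumption
    · exact hG.1 e he
  · rcases Finset.mem_insert.1 he with rfl | he <;> rcases Finset.mem_insert.1 hf with rfl | hf
    · exact absurd rfl hef
    · exact h f hf hef
    · exact fun hc => h e he hef.symm hc.symm
    · exact hG.2 e he f hf hef

section Triangulation

variable {S : Finset Pt} {T : Finset (Sym2 Pt)}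

lemma IsPlaneGraph.left_mem (hT : IsPlaneGraph S T) {a b : Pt} (h : s(a, b) ∈ T) : a ∈ S :=
  (hT.1 _ h).2 a (by simp)

lemma IsPlaneGraph.right_mem (hT : IsPlaneGraph S T) {a b : Pt} (h : s(a, b) ∈ T) : b ∈ S :=
  (hT.1 _ h).2 b (by simp)

lemma IsPlaneGraph.ne (hT : IsPlaneGraph S T) {a b : Pt} (h : s(a, b) ∈ T) : a ≠ b := by
  simpa using (hT.1 _ h).1

lemma IsPlaneGraph.not_mem_openSegment (hT : IsPlaneGraph S T) {a b c d v : Pt}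
    (h1 : s(a, b) ∈ T) (h2 : s(c, d) ∈ T) (hne : s(a, b) ≠ s(c, d))
    (hv1 : v ∈ openSegment ℝ a b) : v ∉ openSegment ℝ c d :=
  fun hv2 => hT.2 _ h1 _ h2 hne (edgesCross_iff.2 ⟨v, hv1, hv2⟩)

lemma IsPlaneGraph.not_segCross (hT : IsPlaneGraph S T) {a b c d : Pt}
    (h1 : s(a, b) ∈ T) (h2 : s(c, d) ∈ T) : ¬ SegCross a b c d := by
  intro h
  by_cases hne : s(a, b) = s(c, d)
  · rcases Sym2.eq_iff.1 hne with ⟨rfl, rfl⟩ | ⟨rfl, rfl⟩ <;> simp [SegCross] at h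
  · exact hT.2 _ h1 _ h2 hne (edgesCross_iff.2 h.exists_mem)

lemma IsTriangulation.exists_segCross (hS : GenPos S) (hT : IsTriangulation S T) {a b : Pt}
    (ha : a ∈ S) (hb : b ∈ S) (hab : a ≠ b) (h : s(a, b) ∉ T) :
    ∃ c d, s(c, d) ∈ T ∧ SegCross a b c d := by
  by_contra hcon
  push Not at hcon
  refine hT.maximal a ha b hb hab h (hT.plane.insert ha hb hab fun f hf hne => ?_)
  induction f using Sym2.ind with
  | _ c d =>
    rw [hS.edgesCross_iff_segCross ha hb (hT.plane.left_mem hf) (hT.plane.right_mem hf) hab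
      (hT.plane.ne hf) hne]
    exact hcon c d hf

/-- The point dividing the segment `a b` in the ratio `t : 1 - t`. -/
def along (a b : Pt) (t : ℝ) : Pt := (a.1 + t * (b.1 - a.1), a.2 + t * (b.2 - a.2))

lemma along_mem_openSegment {a b : Pt} {t : ℝ} (h0 : 0 < t) (h1 : t < 1) :
    along a b t ∈ openSegment ℝ a b :=
  mem_openSegment_iff_coord.2 ⟨t, h0, h1, rfl, rfl⟩

lemma exists_eq_along {v a b : Pt} (hv : v ∈ openSegment ℝ a b) :
    ∃ t : ℝ, 0 < t ∧ t < 1 ∧ v = along a b t := by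
  obtain ⟨t, h0, h1, hx, hy⟩ := mem_openSegment_iff_coord.1 hv
  exact ⟨t, h0, h1, Prod.ext hx hy⟩

lemma along_left_mem_openSegment {v a b : Pt} (hv : v ∈ openSegment ℝ a b) {t : ℝ}
    (h0 : 0 ≤ t) (h1 : t < 1) : along v a t ∈ openSegment ℝ a b := by
  obtain ⟨s, s0, s1, rfl⟩ := exists_eq_along hv
  refine mem_openSegment_iff_coord.2 ⟨(1 - t) * s, mul_pos (by linarith) s0, ?_, ?_, ?_⟩
  · nlinarith
  all_goals simp only [along]; ring

lemma along_right_mem_openSegment {v a b : Pt} (hv : v ∈ openSegment ℝ a b) {t : ℝ}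
    (h0 : 0 ≤ t) (h1 : t < 1) : along v b t ∈ openSegment ℝ a b := by
  rw [openSegment_symm] at hv ⊢
  exact along_left_mem_openSegment hv h0 h1

lemma orient_along (a b c d : Pt) (t : ℝ) :
    orient a b (along c d t) = (1 - t) * orient a b c + t * orient a b d := by
  simp only [orient, along]; ring

lemma IsTriangulation.exists_nearest (hS : GenPos S) (hT : IsTriangulation S T) {a z : Pt}
    (ha : a ∈ S) (hz : z ∈ S) (haz : a ≠ z) (h : s(a, z) ∉ T) :
    ∃ t u w, 0 < t ∧ t < 1 ∧ s(u, w) ∈ T ∧ along a z t ∈ openSegment ℝ u w ∧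
      SegCross a z u w ∧
      ∀ t' u' w', 0 < t' → t' < t → s(u', w') ∈ T → along a z t' ∉ openSegment ℝ u' w' := by
  set Ts : Set ℝ := {t | 0 < t ∧ t < 1 ∧ ∃ u w, s(u, w) ∈ T ∧ along a z t ∈ openSegment ℝ u w}
    with hTs
  have cross : ∀ t u w, 0 < t → t < 1 → s(u, w) ∈ T → along a z t ∈ openSegment ℝ u w →
      SegCross a z u w := by
    intro t u w h0 h1 huw hmem
    rw [← hS.edgesCross_iff_segCross ha hz (hT.plane.left_mem huw) (hT.plane.right_mem huw) haz
      (hT.plane.ne huw) (fun h' => h (h' ▸ huw)), edgesCross_iff]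
    exact ⟨_, along_mem_openSegment h0 h1, hmem⟩
  have hfin : Ts.Finite := by
    refine ((S ×ˢ S).finite_toSet.image
      (fun x : Pt × Pt => orient x.1 x.2 a / (orient x.1 x.2 a - orient x.1 x.2 z))).subset ?_
    rintro t ⟨h0, h1, u, w, huw, hmem⟩
    refine ⟨(u, w), by simp [hT.plane.left_mem huw, hT.plane.right_mem huw], ?_⟩
    have h2 := (cross t u w h0 h1 huw hmem).2
    have h3 := orient_of_mem_openSegment hmem
    rw [orient_along] at h3
    have hD : orient u w a - orient u w z ≠ 0 := by
      intro h4
      rw [sub_eq_zero.1 h4] at h2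
      nlinarith [mul_self_nonneg (orient u w z)]
    simp only
    rw [div_eq_iff hD]
    linarith
  have hne : Ts.Nonempty := by
    obtain ⟨c, d, hcd, hX⟩ := hT.exists_segCross hS ha hz haz h
    obtain ⟨v, h1, h2⟩ := hX.exists_mem
    obtain ⟨t, t0, t1, rfl⟩ := exists_eq_along h1
    exact ⟨t, t0, t1, c, d, hcd, h2⟩
  obtain ⟨t, ⟨t0, t1, u, w, huw, hmem⟩, hmin⟩ := Set.exists_min_image Ts id hfin hne
  refine ⟨t, u, w, t0, t1, huw, hmem, cross t u w t0 t1 huw hmem, ?_⟩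
  intro t' u' w' h0 h1 h2 h3
  have := hmin t' ⟨h0, h1.trans t1, u', w', h2, h3⟩
  simp only [id] at this
  linarith

/-- The point with affine coordinates `α`, `β` in the frame `a`, `x - a`, `y - a`. -/
def comb (a x y : Pt) (α β : ℝ) : Pt :=
  (a.1 + α * (x.1 - a.1) + β * (y.1 - a.1), a.2 + α * (x.2 - a.2) + β * (y.2 - a.2))

set_option maxHeartbeats 1000000 in
lemma IsTriangulation.exists_neighbor_in_triangle (hS : GenPos S) (hT : IsTriangulation S T)
    {a z u w : Pt} {t : ℝ} (ha : a ∈ S) (hz : z ∈ S) (haz : a ≠ z)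
    (t0 : 0 < t) (t1 : t < 1) (huw : s(u, w) ∈ T) (hy : along a z t ∈ openSegment ℝ u w)
    (hX : SegCross a z u w)
    (hnear : ∀ t' u' w', 0 < t' → t' < t → s(u', w') ∈ T →
      along a z t' ∉ openSegment ℝ u' w') :
    ∃ x, s(a, x) ∈ T ∧ ∃ α β, 0 ≤ α ∧ 0 ≤ β ∧ 0 < α + β ∧ α + β ≤ 1 ∧
      x = comb a (along a z t) w α β := by
  set y := along a z t with hydef
  set D := orient a y w with hD
  have hDt : D = t * orient a z w := by simp only [hD, hydef, along, orient]; ring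
  have hw0 : orient a z w ≠ 0 := by
    intro h0
    have := hX.1
    rw [h0, mul_zero] at this
    exact lt_irrefl _ this
  have hD0 : D ≠ 0 := by rw [hDt]; exact mul_ne_zero t0.ne' hw0
  set A : Pt → ℝ := fun x => orient a x w / D with hA
  set B : Pt → ℝ := fun x => orient a y x / D with hB
  have coord : ∀ x, x = comb a y w (A x) (B x) := by
    intro x
    simp only [hA, hB, comb]
    ext
    · simp only
      rw [div_mul_eq_mul_div, div_mul_eq_mul_div, add_assoc, ← add_div,
        ← sub_eq_iff_eq_add', eq_div_iff hD0]
      simp only [hD, orient]; ring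
    · simp only
      rw [div_mul_eq_mul_div, div_mul_eq_mul_div, add_assoc, ← add_div,
        ← sub_eq_iff_eq_add', eq_div_iff hD0]
      simp only [hD, orient]; ring
  have Aal : ∀ p q s, A (along p q s) = A p + s * (A q - A p) := by
    intro p q s
    simp only [hA, along, orient]; ring
  have Bal : ∀ p q s, B (along p q s) = B p + s * (B q - B p) := by
    intro p q s
    simp only [hB, along, orient]; ring
  have Aa : A a = 0 := by simp [hA]
  have Ba : B a = 0 := by simp [hB]
  have Ay : A y = 1 := by simp only [hA]; exact div_self hD0
  have By : B y = 0 := by simp [hB]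
  have Aw : A w = 0 := by simp [hA]
  have Bw : B w = 1 := by simp only [hB]; exact div_self hD0
  have hu1 : A u + B u = 1 := by
    obtain ⟨s, s0, s1, hs⟩ := exists_eq_along hy
    have e1 := Aal u w s
    have e2 := Bal u w s
    rw [← hs, Ay, Aw] at e1
    rw [← hs, By, Bw] at e2
    have : (1 - s) * (A u + B u - 1) = 0 := by linarith
    rcases mul_eq_zero.1 this with h | h <;> linarith
  set C : Finset Pt := S.filter fun x => 0 < B x ∧ 0 ≤ A x ∧ A x + B x ≤ 1 with hC
  have hwC : w ∈ C := by
    simp [hC, hT.plane.right_mem huw, Aw, Bw]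
  obtain ⟨x, hxC, hmax⟩ := Finset.exists_max_image C (fun x => A x / B x) ⟨w, hwC⟩
  simp only [hC, Finset.mem_filter] at hxC
  obtain ⟨hxS, hxB, hxA, hx1⟩ := hxC
  refine ⟨x, ?_, A x, B x, hxA, hxB.le, by linarith, hx1, coord x⟩
  by_contra hax
  have hanex : a ≠ x := by
    rintro rfl
    rw [Ba] at hxB
    exact lt_irrefl _ hxB
  obtain ⟨g1, g2, hg, hXg⟩ := hT.exists_segCross hS ha hxS hanex hax
  set φ : Pt → ℝ := fun p => A p * B x - B p * A x with hφ
  have hφo : ∀ p, orient a x p = - D * φ p := by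
    intro p
    have e : D * (D * φ p) = orient a p w * orient a y x - orient a y p * orient a x w := by
      simp only [hφ, hA, hB]
      field_simp
    have e2 : D * (D * φ p) = D * (- orient a x p) := by
      rw [e]
      simp only [hD, orient]; ring
    have := mul_left_cancel₀ hD0 e2
    linarith
  have hφmul : φ g1 * φ g2 < 0 := by
    have h1 := hXg.1
    rw [hφo, hφo] at h1
    have : 0 < D * D := mul_self_pos.2 hD0
    have h2 : D * D * (φ g1 * φ g2) < 0 := by linarith
    by_contra hcon
    have := mul_nonneg this.le (not_lt.1 hcon)
    linarith
  clear_value A B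
  have main : ∀ g1 g2 : Pt, s(g1, g2) ∈ T → SegCross a x g1 g2 → 0 < φ g1 → False := by
    intro g1 g2 hg hXg hφ1
    obtain ⟨v, hv1, hv2⟩ := hXg.exists_mem
    obtain ⟨τ, τ0, τ1, hvτ⟩ := exists_eq_along hv1
    have Av : A v = τ * A x := by rw [hvτ, Aal, Aa]; ring
    have Bv : B v = τ * B x := by rw [hvτ, Bal, Ba]; ring
    have hvB : 0 < B v := by rw [Bv]; positivity
    have hvs : A v + B v < 1 := by
      rw [Av, Bv, ← mul_add]
      have : 0 < A x + B x := by linarith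
      nlinarith
    have hφal : ∀ μ, φ (along v g1 μ) = μ * φ g1 := by
      intro μ
      simp only [hφ, Aal, Bal, Av, Bv]; ring
    have caseI : ∀ μ : ℝ, 0 < μ → μ < 1 → 1 < A g1 + B g1 →
        A (along v g1 μ) + B (along v g1 μ) = 1 → 0 ≤ B (along v g1 μ) → False := by
      intro μ μ0 μ1 hg1 hsum hBn
      have hφv : 0 < φ (along v g1 μ) := by rw [hφal]; positivity
      set q := along v g1 μ with hq
      have hqg : q ∈ openSegment ℝ g1 g2 := along_left_mem_openSegment hv2 μ0.le μ1
      have hqA : 0 < A q := by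
        by_contra hcon
        have h1 : A q * B x ≤ 0 := mul_nonpos_of_nonpos_of_nonneg (not_lt.1 hcon) hxB.le
        have h2 : 0 ≤ B q * A x := mul_nonneg hBn hxA
        simp only [hφ] at hφv
        linarith
      have hqy : q = along y w (B q) := by
        have h1 := coord q
        have h2 : A q = 1 - B q := by linarith
        rw [h2] at h1
        calc q = comb a y w (1 - B q) (B q) := h1
          _ = along y w (B q) := by
            simp only [comb, along]
            ext <;> simp only <;> ring
      have hqu : q ∈ openSegment ℝ u w := by
        rw [hqy]
        exact along_right_mem_openSegment hy hBn (by linarith)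
      by_cases hne : s(g1, g2) = s(u, w)
      · rcases Sym2.eq_iff.1 hne with ⟨rfl, rfl⟩ | ⟨rfl, rfl⟩
        · linarith
        · linarith
      · exact hT.plane.not_mem_openSegment hg huw hne hqg hqu
    have caseI' : 1 < A g1 + B g1 → 0 ≤ B g1 → False := by
      intro hg1 hBg
      have hd : 0 < (A g1 + B g1) - (A v + B v) := by linarith
      set μ := (1 - (A v + B v)) / ((A g1 + B g1) - (A v + B v)) with hμ
      have μ0 : 0 < μ := div_pos (by linarith) hd
      have μ1 : μ < 1 := by rw [hμ, div_lt_one hd]; linarith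
      refine caseI μ μ0 μ1 hg1 ?_ ?_
      · rw [Aal, Bal]
        have : μ * ((A g1 + B g1) - (A v + B v)) = 1 - (A v + B v) := by
          rw [hμ]; field_simp
        linarith
      · rw [Bal]
        have h1 : 0 ≤ (1 - μ) * B v := mul_nonneg (by linarith) hvB.le
        have h2 : 0 ≤ μ * B g1 := mul_nonneg μ0.le hBg
        linarith
    rcases lt_trichotomy (B g1) 0 with hBg | hBg | hBg
    · have hd : 0 < B v - B g1 := by linarith
      set μ := B v / (B v - B g1) with hμ
      have μ0 : 0 < μ := div_pos hvB hd
      have μ1 : μ < 1 := by rw [hμ, div_lt_one hd]; linarith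
      have hμe : μ * (B v - B g1) = B v := by rw [hμ]; field_simp
      have hB0 : B (along v g1 μ) = 0 := by rw [Bal]; linarith
      have hφv : 0 < φ (along v g1 μ) := by rw [hφal]; positivity
      have hA0 : 0 < A (along v g1 μ) := by
        simp only [hφ, hB0] at hφv
        by_contra hcon
        have := mul_nonpos_of_nonpos_of_nonneg (not_lt.1 hcon) hxB.le
        linarith
      by_cases hA1 : A (along v g1 μ) < 1
      · refine hnear (t * A (along v g1 μ)) g1 g2 (by positivity)
          (mul_lt_of_lt_one_right t0 hA1) hg ?_
        have e : along a z (t * A (along v g1 μ)) = along v g1 μ := by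
          have h1 := coord (along v g1 μ)
          rw [hB0] at h1
          refine Eq.trans ?_ h1.symm
          simp only [comb, hydef]
          simp only [along]
          ext <;> simp only <;> ring
        rw [e]
        exact along_left_mem_openSegment hv2 μ0.le μ1
      · have hA1 := not_lt.1 hA1
        have hge : 1 ≤ (A v + B v) + μ * ((A g1 + B g1) - (A v + B v)) := by
          rw [Aal] at hA1
          linarith
        have hd2 : 0 < (A g1 + B g1) - (A v + B v) := by
          by_contra hcon
          have := mul_nonpos_of_nonneg_of_nonpos μ0.le (not_lt.1 hcon)
          linarith
        have hg1 : 1 < A g1 + B g1 := by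
          have := mul_lt_of_lt_one_left hd2 μ1
          linarith
        set ν := (1 - (A v + B v)) / ((A g1 + B g1) - (A v + B v)) with hν
        have ν0 : 0 < ν := div_pos (by linarith) hd2
        have ν1 : ν < 1 := by rw [hν, div_lt_one hd2]; linarith
        have hνμ : ν ≤ μ := by rw [hν, div_le_iff₀ hd2]; linarith
        refine caseI ν ν0 ν1 hg1 ?_ ?_
        · rw [Aal, Bal]
          have : ν * ((A g1 + B g1) - (A v + B v)) = 1 - (A v + B v) := by
            rw [hν]; field_simp
          linarith
        · rw [Bal]
          have := mul_le_mul_of_nonneg_right hνμ hd.le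
          linarith
    · have hoz : orient a z g1 = 0 := by
        have h1 : g1 = comb a y w (A g1) 0 := by rw [← hBg]; exact coord g1
        rw [h1]
        simp only [comb, hydef, along, orient]; ring
      have hg1 : g1 = a ∨ g1 = z := by
        by_contra hcon
        push Not at hcon
        exact hS.orient_ne_zero ha hz (hT.plane.left_mem hg) haz hcon.1.symm hcon.2.symm hoz
      rcases hg1 with rfl | rfl
      · simp [hφ, Aa, Ba] at hφ1
      · refine caseI' ?_ hBg.ge
        have h1 := Aal a g1 t
        rw [← hydef, Ay, Aa] at h1
        have h2 : t * A g1 = 1 := by linarith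
        have : 1 < A g1 := by
          by_contra hcon
          have := mul_le_mul_of_nonneg_left (not_lt.1 hcon) t0.le
          linarith
        linarith
    · by_cases hg1 : 1 < A g1 + B g1
      · exact caseI' hg1 hBg.le
      · have hAg : 0 < A g1 := by
          simp only [hφ] at hφ1
          by_contra hcon
          have h1 := mul_nonpos_of_nonpos_of_nonneg (not_lt.1 hcon) hxB.le
          have h2 := mul_nonneg hBg.le hxA
          linarith
        have := hmax g1 (by
          simp only [hC, Finset.mem_filter]
          exact ⟨hT.plane.left_mem hg, hBg, hAg.le, not_lt.1 hg1⟩)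
        rw [div_le_div_iff₀ hBg hxB] at this
        simp only [hφ] at hφ1
        linarith
  rcases mul_neg_iff.1 hφmul with ⟨h1, -⟩ | ⟨-, h1⟩
  · exact main g1 g2 hg hXg h1
  · exact main g2 g1 (by rwa [Sym2.eq_swap]) hXg.swap_right h1

lemma IsTriangulation.exists_neighbor_of_region (hS : GenPos S) (hT : IsTriangulation S T)
    {a z : Pt} (R : Pt → Prop) (ha : a ∈ S) (hz : z ∈ S) (hRz : R z) (hRa : ¬ R a)
    (hcone : ∀ x y, R x → R y → ∀ α β, 0 ≤ α → 0 ≤ β → 0 < α + β → α + β ≤ 1 →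
      R (comb a x y α β))
    (hend : ∀ u w y, s(u, w) ∈ T → SegCross a z u w → R y → y ∈ openSegment ℝ u w →
      R u ∨ R w) :
    ∃ x, s(a, x) ∈ T ∧ R x := by
  by_cases h : s(a, z) ∈ T
  · exact ⟨z, h, hRz⟩
  have haz : a ≠ z := fun h => hRa (h ▸ hRz)
  obtain ⟨t, u, w, t0, t1, huw, hy, hX, hnear⟩ := hT.exists_nearest hS ha hz haz h
  have hRy : R (along a z t) := by
    have := hcone z z hRz hRz t 0 t0.le le_rfl (by linarith) (by linarith)
    simpa [comb, along] using this
  have fin : ∀ u w, s(u, w) ∈ T → along a z t ∈ openSegment ℝ u w → SegCross a z u w → R w →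
      ∃ x, s(a, x) ∈ T ∧ R x := by
    intro u w huw hy hX hw
    obtain ⟨x, hx, α, β, h1, h2, h3, h4, rfl⟩ :=
      hT.exists_neighbor_in_triangle hS ha hz haz t0 t1 huw hy hX hnear
    exact ⟨_, hx, hcone _ _ hRy hw _ _ h1 h2 h3 h4⟩
  rcases hend u w _ huw hX hRy hy with hu | hw
  · exact fin w u (by rwa [Sym2.eq_swap]) (by rwa [openSegment_symm]) hX.swap_right hu
  · exact fin u w huw hy hX hw

lemma orient_comb (a b x y : Pt) (α β : ℝ) :
    orient a b (comb a x y α β) = α * orient a b x + β * orient a b y := by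
  simp only [orient, comb]; ring

lemma pos_of_comb {α β x y : ℝ} (hα : 0 ≤ α) (hβ : 0 ≤ β) (h : 0 < α + β)
    (hx : 0 < x) (hy : 0 < y) : 0 < α * x + β * y := by
  rcases hα.eq_or_lt with rfl | hα
  · have : 0 < β := by linarith
    positivity
  · positivity

lemma pos_or_pos_of_convex {x y s : ℝ} (h0 : 0 < s) (h1 : s < 1)
    (h : 0 < (1 - s) * x + s * y) : 0 < x ∨ 0 < y := by
  by_contra! hcon
  have h2 := mul_nonpos_of_nonneg_of_nonpos (sub_pos.2 h1).le hcon.1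
  have h3 := mul_nonpos_of_nonneg_of_nonpos h0.le hcon.2
  linarith

lemma IsTriangulation.exists_neighbor_left (hS : GenPos S) (hT : IsTriangulation S T)
    {a b z : Pt} (ha : a ∈ S) (hz : z ∈ S) (h : 0 < orient a b z) :
    ∃ x, s(a, x) ∈ T ∧ 0 < orient a b x := by
  refine hT.exists_neighbor_of_region hS (fun x => 0 < orient a b x) ha hz h (by simp) ?_ ?_
  · intro x y hx hy α β h1 h2 h3 h4
    rw [orient_comb]
    exact pos_of_comb h1 h2 h3 hx hy
  · intro u w y _ _ hy hmem
    obtain ⟨s, h0, h1, hs⟩ := exists_affine_of_mem_openSegment hmem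
    rw [hs] at hy
    exact pos_or_pos_of_convex h0 h1 hy

lemma exists_extremal_angle {p q : Pt} {N : Finset Pt} (hN : N.Nonempty)
    (h : ∀ x ∈ N, 0 < orient p q x) :
    (∃ x ∈ N, ∀ x' ∈ N, orient p x' x ≤ 0) ∧ (∃ x ∈ N, ∀ x' ∈ N, orient p x x' ≤ 0) := by
  set f : Pt → ℝ := fun x => ((x.1 - p.1) * (q.1 - p.1) + (x.2 - p.2) * (q.2 - p.2)) / orient p q x
    with hf
  have hpq : 0 < (q.1 - p.1) ^ 2 + (q.2 - p.2) ^ 2 := by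
    obtain ⟨x, hx⟩ := hN
    have := h x hx
    by_contra hcon
    have h1 : q.1 - p.1 = 0 := by nlinarith [sq_nonneg (q.1 - p.1), sq_nonneg (q.2 - p.2)]
    have h2 : q.2 - p.2 = 0 := by nlinarith [sq_nonneg (q.1 - p.1), sq_nonneg (q.2 - p.2)]
    simp [orient, h1, h2] at this
  have key : ∀ x ∈ N, ∀ y ∈ N, f x ≤ f y → orient p x y ≤ 0 := by
    intro x hx y hy hxy
    simp only [hf] at hxy
    rw [div_le_div_iff₀ (h x hx) (h y hy)] at hxy
    have e : ((y.1 - p.1) * (q.1 - p.1) + (y.2 - p.2) * (q.2 - p.2)) * orient p q x -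
        ((x.1 - p.1) * (q.1 - p.1) + (x.2 - p.2) * (q.2 - p.2)) * orient p q y =
        ((q.1 - p.1) ^ 2 + (q.2 - p.2) ^ 2) * (- orient p x y) := by
      simp only [orient]; ring
    have h1 : 0 ≤ ((q.1 - p.1) ^ 2 + (q.2 - p.2) ^ 2) * (- orient p x y) := by linarith
    have := nonneg_of_mul_nonneg_right h1 hpq
    linarith
  obtain ⟨x, hx, hx'⟩ := N.exists_max_image f hN
  obtain ⟨y, hy, hy'⟩ := N.exists_min_image f hN
  exact ⟨⟨x, hx, fun x' h' => key x' h' x hx (hx' x' h')⟩,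
    ⟨y, hy, fun x' h' => key y hy x' h' (hy' x' h')⟩⟩

/-- A counterclockwise triangle with all sides in `T` and no point of `S` in its interior. -/
structure EmptyTri (S : Finset Pt) (T : Finset (Sym2 Pt)) (a b c : Pt) : Prop where
  mem₁ : s(a, b) ∈ T
  mem₂ : s(b, c) ∈ T
  mem₃ : s(c, a) ∈ T
  pos : 0 < orient a b c
  empty : ∀ x ∈ S, 0 < orient a b x → 0 < orient b c x → 0 < orient c a x → False

lemma EmptyTri.rotate {a b c : Pt} (h : EmptyTri S T a b c) : EmptyTri S T b c a :=
  ⟨h.mem₂, h.mem₃, h.mem₁, by rw [← orient_rotate]; exact h.pos,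
    fun x hx h1 h2 h3 => h.empty x hx h3 h1 h2⟩

lemma exists_first_zero {f₁ f₂ g₁ g₂ : ℝ} (h1 : 0 < f₁) (h2 : 0 < f₂) (h : g₁ ≤ 0 ∨ g₂ ≤ 0) :
    ∃ μ, 0 < μ ∧ μ ≤ 1 ∧
      ((f₁ + μ * (g₁ - f₁) = 0 ∧ 0 ≤ f₂ + μ * (g₂ - f₂)) ∨
        (f₂ + μ * (g₂ - f₂) = 0 ∧ 0 ≤ f₁ + μ * (g₁ - f₁))) := by
  have aux : ∀ {f₁ f₂ g₁ g₂ : ℝ}, 0 < f₁ → 0 < f₂ → g₁ ≤ 0 → g₂ * f₁ ≥ g₁ * f₂ →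
      ∃ μ, 0 < μ ∧ μ ≤ 1 ∧ f₁ + μ * (g₁ - f₁) = 0 ∧ 0 ≤ f₂ + μ * (g₂ - f₂) := by
    intro f₁ f₂ g₁ g₂ h1 h2 h3 h4
    have hd : 0 < f₁ - g₁ := by linarith
    refine ⟨f₁ / (f₁ - g₁), by positivity, by rw [div_le_one hd]; linarith, ?_, ?_⟩
    · field_simp; ring
    · have : f₂ + f₁ / (f₁ - g₁) * (g₂ - f₂) = (g₂ * f₁ - g₁ * f₂) / (f₁ - g₁) := by
        field_simp; ring
      rw [this]
      exact div_nonneg (by linarith) hd.le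
  by_cases hc : g₂ * f₁ ≥ g₁ * f₂
  · have hg1 : g₁ ≤ 0 := by
      rcases h with h | h
      · exact h
      · by_contra hcon
        have := mul_pos (not_le.1 hcon) h2
        have := mul_nonpos_of_nonpos_of_nonneg h h1.le
        linarith
    obtain ⟨μ, m0, m1, m2, m3⟩ := aux h1 h2 hg1 hc
    exact ⟨μ, m0, m1, Or.inl ⟨m2, m3⟩⟩
  · have hc := (not_le.1 hc).le
    have hg2 : g₂ ≤ 0 := by
      rcases h with h | h
      · by_contra hcon
        have := mul_pos (not_le.1 hcon) h1
        have := mul_nonpos_of_nonpos_of_nonneg h h2.le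
        linarith
      · exact h
    obtain ⟨μ, m0, m1, m2, m3⟩ := aux h2 h1 hg2 hc
    exact ⟨μ, m0, m1, Or.inr ⟨m2, m3⟩⟩

lemma eq_along_of_orient {a b c v : Pt} (hD : orient a b c ≠ 0) (h : orient a b v = 0) :
    v = along a b (orient c a v / orient a b c) := by
  simp only [along]
  ext
  · simp only
    rw [div_mul_eq_mul_div, ← sub_eq_iff_eq_add', eq_div_iff hD]
    simp only [orient] at h ⊢
    linear_combination (c.1 - a.1) * h
  · simp only
    rw [div_mul_eq_mul_div, ← sub_eq_iff_eq_add', eq_div_iff hD]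
    simp only [orient] at h ⊢
    linear_combination (c.2 - a.2) * h

lemma orient_sum (a b c v : Pt) :
    orient a b v + orient b c v + orient c a v = orient a b c := by
  simp only [orient]; ring

lemma IsTriangulation.no_exit (hS : GenPos S) (hT : IsTriangulation S T) {a e u w y : Pt}
    {μ κ : ℝ} (hae : s(a, e) ∈ T) (huw : s(u, w) ∈ T) (ha : orient u w a ≠ 0)
    (hy : y ∈ openSegment ℝ u w) (μ0 : 0 < μ) (μ1 : μ ≤ 1) (κ0 : 0 ≤ κ) (κ1 : κ < 1)
    (h : along y w μ = along a e κ) : False := by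
  have hv : orient u w (along y w μ) = 0 := by
    rw [orient_along, orient_of_mem_openSegment hy]; simp
  rcases κ0.eq_or_lt with rfl | κ0
  · apply ha
    rw [h] at hv
    simpa [along] using hv
  have hmem := along_mem_openSegment (a := a) (b := e) κ0 κ1
  rw [← h] at hmem
  rcases μ1.eq_or_lt with rfl | μ1
  · have hw : along y w 1 = w := by simp [along]
    rw [hw] at hmem h
    have h0 := orient_of_mem_openSegment hmem
    have hw' : w = a ∨ w = e := by
      by_contra hcon
      push Not at hcon
      exact hS.orient_ne_zero (hT.plane.left_mem hae) (hT.plane.right_mem hae)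
        (hT.plane.right_mem huw) (hT.plane.ne hae) hcon.1.symm hcon.2.symm h0
    rcases hw' with rfl | rfl
    · simp at ha
    · apply hT.plane.ne hae
      have h1 := congrArg Prod.fst h
      have h2 := congrArg Prod.snd h
      simp only [along] at h1 h2
      have hκ : (1 - κ) ≠ 0 := by linarith
      refine Prod.ext (mul_left_cancel₀ hκ ?_) (mul_left_cancel₀ hκ ?_) <;> linarith
  · have hmem2 := along_right_mem_openSegment hy μ0.le μ1
    by_cases hne : s(a, e) = s(u, w)
    · rcases Sym2.eq_iff.1 hne with ⟨rfl, rfl⟩ | ⟨rfl, rfl⟩ <;> simp at ha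
    · exact hT.plane.not_mem_openSegment hae huw hne hmem hmem2

lemma IsTriangulation.endpoint_mem_triangle (hS : GenPos S) (hT : IsTriangulation S T)
    {a b c u w y : Pt} (hab : s(a, b) ∈ T) (hac : s(a, c) ∈ T) (hpos : 0 < orient a b c)
    (huw : s(u, w) ∈ T) (ha : orient u w a ≠ 0) (hy : y ∈ openSegment ℝ u w)
    (hy1 : 0 < orient a b y) (hy2 : 0 < orient b c y) (hy3 : 0 < orient c a y)
    (hw : 0 < orient b c w) : 0 < orient a b w ∧ 0 < orient c a w := by
  by_contra hcon
  have hcon' : orient a b w ≤ 0 ∨ orient c a w ≤ 0 := by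
    by_contra! h
    exact hcon h
  obtain ⟨μ, μ0, μ1, h⟩ := exists_first_zero hy1 hy3 hcon'
  set v := along y w μ with hv
  have e1 : orient a b v = orient a b y + μ * (orient a b w - orient a b y) := by
    rw [orient_along]; ring
  have e3 : orient c a v = orient c a y + μ * (orient c a w - orient c a y) := by
    rw [orient_along]; ring
  have e2 : 0 < orient b c v := by
    rw [orient_along]
    have := mul_nonneg (sub_nonneg.2 μ1) hy2.le
    have := mul_pos μ0 hw
    linarith
  have hsum := orient_sum a b c v
  rw [← e1, ← e3] at h
  rcases h with ⟨h1, h2⟩ | ⟨h1, h2⟩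
  · have := eq_along_of_orient hpos.ne' h1
    exact hT.no_exit hS hab huw ha hy μ0 μ1 (div_nonneg h2 hpos.le)
      (by rw [div_lt_one hpos]; linarith) this
  · have h1' : orient a c v = 0 := by rw [orient_swap]; linarith
    have hneg : orient a c b = - orient a b c := orient_swap_right _ _ _
    have := eq_along_of_orient (a := a) (b := c) (c := b) (v := v)
      (by rw [hneg]; linarith) h1'
    rw [hneg, orient_swap b a v, neg_div_neg_eq] at this
    exact hT.no_exit hS hac huw ha hy μ0 μ1 (div_nonneg h2 hpos.le)
      (by rw [div_lt_one hpos]; linarith) this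

lemma IsTriangulation.exists_emptyTri (hS : GenPos S) (hT : IsTriangulation S T) {a b q : Pt}
    (hab : s(a, b) ∈ T) (hq : q ∈ S) (h : 0 < orient a b q) : ∃ c, EmptyTri S T a b c := by
  have ha := hT.plane.left_mem hab
  have hb := hT.plane.right_mem hab
  set N := S.filter fun x => s(a, x) ∈ T ∧ 0 < orient a b x with hN
  have hNne : N.Nonempty := by
    obtain ⟨x, hx, hpos⟩ := hT.exists_neighbor_left hS ha hq h
    exact ⟨x, by simp [hN, hx, hpos, hT.plane.right_mem hx]⟩
  obtain ⟨c, hc, hmin⟩ := (exists_extremal_angle hNne (p := a) (q := b)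
    (fun x hx => (Finset.mem_filter.1 hx).2.2)).1
  simp only [hN, Finset.mem_filter] at hc
  obtain ⟨hcS, hac, hpos⟩ := hc
  have hempty : ∀ x ∈ S, 0 < orient a b x → 0 < orient b c x → 0 < orient c a x → False := by
    intro x hx h1 h2 h3
    obtain ⟨d, hd, hd1, -, hd3⟩ := hT.exists_neighbor_of_region hS
      (fun x => 0 < orient a b x ∧ 0 < orient b c x ∧ 0 < orient c a x) ha hx ⟨h1, h2, h3⟩
      (by simp) (by
        rintro x y ⟨hx1, hx2, hx3⟩ ⟨hy1, hy2, hy3⟩ α β hα hβ h0 h1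
        refine ⟨?_, ?_, ?_⟩
        · rw [orient_comb]
          exact pos_of_comb hα hβ h0 hx1 hy1
        · have e : orient b c (comb a x y α β) =
              (1 - α - β) * orient a b c + (α * orient b c x + β * orient b c y) := by
            simp only [orient, comb]; ring
          rw [e]
          have := mul_nonneg (by linarith : 0 ≤ 1 - α - β) hpos.le
          have := pos_of_comb hα hβ h0 hx2 hy2
          linarith
        · have e : orient c a (comb a x y α β) = α * orient c a x + β * orient c a y := by
            simp only [orient, comb]; ring
          rw [e]
          exact pos_of_comb hα hβ h0 hx3 hy3) (by
        rintro u w y huw hX ⟨hy1, hy2, hy3⟩ hmem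
        have ha0 : orient u w a ≠ 0 := by
          intro h0
          have := hX.2
          rw [h0, zero_mul] at this
          exact lt_irrefl _ this
        obtain ⟨s, h0, h1, hs⟩ := exists_affine_of_mem_openSegment hmem
        have hy2' := hy2
        rw [hs] at hy2'
        rcases pos_or_pos_of_convex h0 h1 hy2' with hu | hw
        · obtain ⟨k1, k3⟩ := hT.endpoint_mem_triangle hS hab hac hpos (u := w) (w := u)
            (by rwa [Sym2.eq_swap]) (by rw [orient_swap]; exact neg_ne_zero.2 ha0)
            (by rwa [openSegment_symm]) hy1 hy2 hy3 hu
          exact Or.inl ⟨k1, hu, k3⟩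
        · obtain ⟨k1, k3⟩ := hT.endpoint_mem_triangle hS hab hac hpos huw ha0 hmem hy1 hy2 hy3 hw
          exact Or.inr ⟨k1, hw, k3⟩)
    have := hmin d (by simp [hN, hd, hd1, hT.plane.right_mem hd])
    rw [orient_rotate] at hd3
    linarith
  refine ⟨c, hab, ?_, by rwa [Sym2.eq_swap], hpos, hempty⟩
  have hbc : b ≠ c := by
    rintro rfl
    simp at hpos
  by_contra hbcT
  obtain ⟨u, w, huw, hX⟩ := hT.exists_segCross hS hb hcS hbc hbcT
  have main : ∀ u w, s(u, w) ∈ T → SegCross b c u w → 0 < orient b c w → False := by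
    intro u w huw hX hw
    obtain ⟨v, hv1, hv2⟩ := hX.exists_mem
    have hwS := hT.plane.right_mem huw
    have hu : orient b c u < 0 := by
      by_contra hcon
      have := mul_nonneg (not_lt.1 hcon) hw.le
      exact absurd hX.1 (not_lt.2 this)
    obtain ⟨τ, τ0, τ1, rfl⟩ := exists_eq_along hv1
    obtain ⟨σ, σ0, σ1, hσ⟩ := exists_eq_along hv2
    have hab0 : 0 < orient a b (along b c τ) := by
      rw [orient_along]; simp; positivity
    have hca0 : 0 < orient c a (along b c τ) := by
      rw [orient_along, orient_rotate c a b]; simp; exact mul_pos (by linarith) hpos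
    by_cases hu0 : orient u w a = 0
    · have : a = u ∨ a = w := by
        by_contra hcon
        push Not at hcon
        exact hS.orient_ne_zero (hT.plane.left_mem huw) hwS ha (hT.plane.ne huw)
          hcon.1.symm hcon.2.symm hu0
      rcases this with rfl | rfl
      · rw [← orient_rotate] at hu
        linarith
      · have ha1 : 0 < orient a b u := by
          have h1 := orient_along a b u a σ
          rw [← hσ] at h1
          simp only [orient_self_outer, mul_zero, add_zero] at h1
          rw [h1] at hab0
          exact pos_of_mul_pos_right hab0 (by linarith)
        have ha2 : 0 < orient c a u := by
          have h1 := orient_along c a u a σ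
          rw [← hσ] at h1
          simp only [orient_self_right, mul_zero, add_zero] at h1
          rw [h1] at hca0
          exact pos_of_mul_pos_right hca0 (by linarith)
        have := hmin u (by
          simp [hN, ha1, hT.plane.left_mem huw, Sym2.eq_swap ▸ huw])
        rw [orient_rotate] at ha2
        linarith
    · set v := along b c τ with hv
      have hstep : ∃ y, y ∈ openSegment ℝ u w ∧ 0 < orient a b y ∧ 0 < orient b c y ∧
          0 < orient c a y := by
        have hbc0 : orient b c v = 0 := by rw [hv, orient_along]; simp
        have hlim : ∀ f₀ f₁ : ℝ, 0 < f₀ → ∃ δ, 0 < δ ∧ ∀ ε, 0 < ε → ε ≤ δ →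
            0 < (1 - ε) * f₀ + ε * f₁ := by
          intro f₀ f₁ hf
          have hd : 0 < f₀ + |f₀ - f₁| := by positivity
          refine ⟨f₀ / (2 * (f₀ + |f₀ - f₁|)), by positivity, fun ε h0 h1 => ?_⟩
          rw [le_div_iff₀ (by positivity)] at h1
          have h2 := mul_le_mul_of_nonneg_left (le_abs_self (f₀ - f₁)) h0.le
          have h3 := mul_pos h0 hf
          linarith
        obtain ⟨δ₁, d1, hd1⟩ := hlim _ (orient a b w) hab0
        obtain ⟨δ₂, d2, hd2⟩ := hlim _ (orient c a w) hca0
        set ε := min (min δ₁ δ₂) (1 / 2) with hε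
        have ε0 : 0 < ε := by positivity
        have ε1 : ε < 1 := lt_of_le_of_lt (min_le_right _ _) (by norm_num)
        refine ⟨along v w ε, along_right_mem_openSegment hv2 ε0.le ε1, ?_, ?_, ?_⟩
        · rw [orient_along]
          exact hd1 ε ε0 ((min_le_left _ _).trans (min_le_left _ _))
        · rw [orient_along, hbc0]
          have := mul_pos ε0 hw
          linarith
        · rw [orient_along]
          exact hd2 ε ε0 ((min_le_left _ _).trans (min_le_right _ _))
      obtain ⟨y, hy, hy1, hy2, hy3⟩ := hstep
      obtain ⟨k1, k3⟩ := hT.endpoint_mem_triangle hS hab hac hpos huw hu0 hy hy1 hy2 hy3 hw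
      exact hempty w hwS k1 hw k3
  rcases mul_neg_iff.1 hX.1 with ⟨h1, -⟩ | ⟨-, h1⟩
  · exact main w u (by rwa [Sym2.eq_swap]) hX.swap_right h1
  · exact main u w huw hX h1

lemma EmptyTri.ne₁₂ {a b c : Pt} (h : EmptyTri S T a b c) : a ≠ b := by
  rintro rfl
  simpa using h.pos

lemma EmptyTri.ne₂₃ {a b c : Pt} (h : EmptyTri S T a b c) : b ≠ c := h.rotate.ne₁₂

lemma EmptyTri.segCross_of_wedge (hS : GenPos S) (hT : IsPlaneGraph S T) {a b c d : Pt}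
    (h : EmptyTri S T a b c) (hd : d ∈ S) (h1 : 0 < orient a b d) (h2 : 0 < orient a d c) :
    SegCross a d b c := by
  have hbd : b ≠ d := by
    rintro rfl
    simp at h1
  have hcd : c ≠ d := by
    rintro rfl
    simp at h2
  have h3 := hS.orient_ne_zero (hT.left_mem h.mem₂) (hT.right_mem h.mem₂) hd h.ne₂₃ hbd hcd
  have h4 : orient b c d < 0 := by
    refine lt_of_le_of_ne ?_ h3
    by_contra hcon
    exact h.empty d hd h1 (not_le.1 hcon) (by rwa [orient_rotate])
  refine ⟨mul_neg_of_neg_of_pos ?_ h2, mul_neg_of_pos_of_neg ?_ h4⟩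
  · rw [orient_swap_right]; linarith
  · rw [← orient_rotate]; exact h.pos

lemma EmptyTri.not_wedge (hS : GenPos S) (hT : IsPlaneGraph S T) {a b c d : Pt}
    (h : EmptyTri S T a b c) (hd : s(a, d) ∈ T) (h1 : 0 < orient a b d)
    (h2 : 0 < orient a d c) : False :=
  hT.not_segCross hd h.mem₂ (h.segCross_of_wedge hS hT (hT.right_mem hd) h1 h2)

lemma EmptyTri.unique (hS : GenPos S) (hT : IsPlaneGraph S T) {a b c c' : Pt}
    (h : EmptyTri S T a b c) (h' : EmptyTri S T a b c') : c = c' := by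
  by_contra hne
  have hac : s(a, c) ∈ T := by rw [Sym2.eq_swap]; exact h.mem₃
  have hac' : s(a, c') ∈ T := by rw [Sym2.eq_swap]; exact h'.mem₃
  have h0 := hS.orient_ne_zero (hT.left_mem hac) (hT.right_mem hac) (hT.right_mem hac')
    (hT.ne hac) (hT.ne hac') hne
  rcases lt_or_gt_of_ne h0 with h0 | h0
  · rw [orient_swap_right] at h0
    exact h.not_wedge hS hT hac' h'.pos (by linarith)
  · exact h'.not_wedge hS hT hac h.pos h0

lemma IsTriangulation.exists_neighbor (hS : GenPos S) (hT : IsTriangulation S T) {p q : Pt}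
    (hp : p ∈ S) (hq : q ∈ S) (hpq : p ≠ q) : ∃ r, s(p, r) ∈ T := by
  obtain ⟨r, hr, -⟩ := hT.exists_neighbor_left hS hp hq
    (b := (p.1 + (q.2 - p.2), p.2 - (q.1 - p.1))) (by
      have e : orient p (p.1 + (q.2 - p.2), p.2 - (q.1 - p.1)) q =
          (q.1 - p.1) ^ 2 + (q.2 - p.2) ^ 2 := by
        simp only [orient]; ring
      rw [e]
      by_contra hcon
      apply hpq
      ext
      · nlinarith [sq_nonneg (q.1 - p.1), sq_nonneg (q.2 - p.2)]
      · nlinarith [sq_nonneg (q.1 - p.1), sq_nonneg (q.2 - p.2)])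
  exact ⟨r, hr⟩

lemma IsTriangulation.exists_link_segCross (hS : GenPos S) (hT : IsTriangulation S T) {p q : Pt}
    (hp : p ∈ S) (hq : q ∈ S) (hpq : p ≠ q) (h : s(p, q) ∉ T) :
    ∃ a b, EmptyTri S T p a b ∧ SegCross p q a b := by
  obtain ⟨r, hr⟩ := hT.exists_neighbor hS hp hq hpq
  have hor : ∀ x, s(p, x) ∈ T → orient p q x ≠ 0 := by
    intro x hx
    refine hS.orient_ne_zero hp hq (hT.plane.right_mem hx) hpq (hT.plane.ne hx) ?_
    rintro rfl
    exact h hx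
  rcases lt_or_gt_of_ne (hor r hr) with h0 | h0
  · set q' : Pt := (2 * p.1 - q.1, 2 * p.2 - q.2) with hq'
    have hneg : ∀ x, orient p q' x = orient p x q := by
      intro x
      simp only [hq', orient]; ring
    have hsw : ∀ x, orient p x q = - orient p q x := fun x => orient_swap_right _ _ _
    set N := S.filter fun x => s(p, x) ∈ T ∧ 0 < orient p q' x with hN
    have hNne : N.Nonempty :=
      ⟨r, by simp [hN, hr, hneg, hsw, h0, hT.plane.right_mem hr]⟩
    obtain ⟨x, hx, hmax⟩ := (exists_extremal_angle hNne (p := p) (q := q')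
      (fun x hx => (Finset.mem_filter.1 hx).2.2)).2
    simp only [hN, Finset.mem_filter, hneg] at hx
    obtain ⟨hxS, hxT, hxpos⟩ := hx
    obtain ⟨c, hc⟩ := hT.exists_emptyTri hS hxT hq hxpos
    have hcT : s(p, c) ∈ T := by rw [Sym2.eq_swap]; exact hc.mem₃
    have hqc : 0 < orient p q c := by
      refine lt_of_le_of_ne ?_ (hor c hcT).symm
      by_contra hcon
      have := hmax c (by
        simp only [hN, Finset.mem_filter, hneg, hsw]
        exact ⟨hT.plane.right_mem hcT, hcT, by linarith⟩)
      linarith [hc.pos]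
    exact ⟨x, c, hc, hc.segCross_of_wedge hS hT.plane hq hxpos hqc⟩
  · set N := S.filter fun x => s(p, x) ∈ T ∧ 0 < orient p q x with hN
    have hNne : N.Nonempty := ⟨r, by simp [hN, hr, h0, hT.plane.right_mem hr]⟩
    obtain ⟨x, hx, hmin⟩ := (exists_extremal_angle hNne (p := p) (q := q)
      (fun x hx => (Finset.mem_filter.1 hx).2.2)).1
    simp only [hN, Finset.mem_filter] at hx
    obtain ⟨hxS, hxT, hxpos⟩ := hx
    obtain ⟨c, hc⟩ := hT.exists_emptyTri hS (a := x) (b := p) (by rwa [Sym2.eq_swap]) hq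
      (by rwa [orient_rotate])
    have hc := hc.rotate
    have hcT : s(p, c) ∈ T := hc.mem₁
    have hqc : orient p q c < 0 := by
      refine lt_of_le_of_ne ?_ (hor c hcT)
      by_contra hcon
      have := hmin c (by
        simp only [hN, Finset.mem_filter]
        exact ⟨hT.plane.right_mem hcT, hcT, not_le.1 hcon⟩)
      linarith [hc.pos]
    exact ⟨c, x, hc, hc.segCross_of_wedge hS hT.plane hq
      (by rw [orient_swap_right]; linarith) hxpos⟩

lemma pos_of_mul_neg {x y : ℝ} (h : x * y < 0) (hx : x < 0) : 0 < y := by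
  by_contra hcon
  have := mul_nonneg_of_nonpos_of_nonpos hx.le (not_lt.1 hcon)
  linarith

lemma neg_of_mul_neg {x y : ℝ} (h : x * y < 0) (hx : 0 < x) : y < 0 := by
  by_contra hcon
  have := mul_nonneg hx.le (not_lt.1 hcon)
  linarith

lemma exit_signs {la lb lc qa qb qc pa pb pc D : ℝ} (hla : la < 0) (hlb : 0 < lb) (hlc : 0 < lc)
    (hq : qa * la + qb * lb + qc * lc = 0) (hp : pa * la + pb * lb + pc * lc = 0)
    (hqc : 0 < qc) (hpc : pc < 0) (hD : 0 < D) (hps : pa + pb + pc = D)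
    (hout : qb < 0 ∨ qa < 0) : qb < 0 ∧ 0 < pb := by
  constructor
  · rcases hout with h | h
    · exact h
    · by_contra hcon
      have h1 := mul_nonneg (not_lt.1 hcon) hlb.le
      have h2 := mul_pos_of_neg_of_neg h hla
      have h3 := mul_pos hqc hlc
      linarith
  · by_contra hcon
    have hcon := not_lt.1 hcon
    have h1 := mul_nonpos_of_nonpos_of_nonneg hcon hlb.le
    have h2 := mul_neg_of_neg_of_pos hpc hlc
    have h3 : pa * la < 0 := mul_neg_of_pos_of_neg (by linarith) hla
    linarith

lemma exit_signs' {la lb lc qa qb qc pa pb pc D : ℝ} (hab : la * lb < 0) (hac : la * lc < 0)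
    (hq : qa * la + qb * lb + qc * lc = 0) (hp : pa * la + pb * lb + pc * lc = 0)
    (hqc : 0 < qc) (hpc : pc < 0) (hD : 0 < D) (hps : pa + pb + pc = D)
    (hout : qb < 0 ∨ qa < 0) : pb * qb < 0 := by
  rcases lt_trichotomy la 0 with h | h | h
  · obtain ⟨h1, h2⟩ := exit_signs h (pos_of_mul_neg hab h) (pos_of_mul_neg hac h) hq hp hqc hpc
      hD hps hout
    exact mul_neg_of_pos_of_neg h2 h1
  · simp [h] at hab
  · obtain ⟨h1, h2⟩ := exit_signs (la := -la) (lb := -lb) (lc := -lc) (by linarith)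
      (neg_pos.2 (neg_of_mul_neg hab h)) (neg_pos.2 (neg_of_mul_neg hac h))
      (by linarith) (by linarith) hqc hpc hD hps hout
    exact mul_neg_of_pos_of_neg h2 h1

lemma IsPlaneGraph.segCross_opposite (hS : GenPos S) (hT : IsPlaneGraph S T) {p q a b c : Pt}
    (hq : q ∈ S) (hpab : EmptyTri S T p a b) (hX : SegCross p q a b) (hbac : EmptyTri S T b a c)
    (hqc : q ≠ c) : SegCross p q b c ∨ SegCross p q a c := by
  have hp := hT.left_mem hpab.mem₁
  have ha := hT.left_mem hpab.mem₂
  have hb := hT.right_mem hpab.mem₂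
  have hc := hT.right_mem hbac.mem₂
  have hpq : p ≠ q := by
    rintro rfl
    simp [SegCross] at hX
  have hp0 : orient b a p < 0 := by
    rw [orient_swap, ← orient_rotate]; linarith [hpab.pos]
  have hq0 : 0 < orient b a q := by
    have h2 := hX.2
    rw [orient_swap a b, orient_swap a b, neg_mul_neg] at h2
    exact pos_of_mul_neg h2 hp0
  have hpc : p ≠ c := by
    rintro rfl
    linarith [hbac.pos]
  have hqa : q ≠ a := by
    rintro rfl
    simp at hq0
  have hqb : q ≠ b := by
    rintro rfl
    simp at hq0
  have hlc : orient p q c ≠ 0 := hS.orient_ne_zero hp hq hc hpq hpc hqc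
  have hout : orient a c q < 0 ∨ orient c b q < 0 := by
    by_contra! hcon
    have h1 := hS.orient_ne_zero ha hc hq hbac.ne₂₃ hqa.symm hqc.symm
    have h2 := hS.orient_ne_zero hc hb hq hbac.rotate.ne₂₃ hqc.symm hqb.symm
    exact hbac.empty q hq hq0 (lt_of_le_of_ne hcon.1 h1.symm) (lt_of_le_of_ne hcon.2 h2.symm)
  have eqq : orient c b q * orient p q a + orient a c q * orient p q b +
      orient b a q * orient p q c = 0 := by
    simp only [orient]; ring
  have eqp : orient c b p * orient p q a + orient a c p * orient p q b +
      orient b a p * orient p q c = 0 := by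
    simp only [orient]; ring
  have hsum : orient c b p + orient a c p + orient b a p = orient b a c := by
    simp only [orient]; ring
  have h1 := hX.1
  by_cases hac : orient p q a * orient p q c < 0
  · right
    exact ⟨hac, exit_signs' h1 hac eqq eqp hq0 hp0 hbac.pos hsum hout⟩
  · left
    have hbc : orient p q b * orient p q c < 0 := by
      have ha0 : orient p q a ≠ 0 := by
        intro h0
        simp [h0] at h1
      have hac : 0 < orient p q a * orient p q c :=
        lt_of_le_of_ne (not_lt.1 hac) (mul_ne_zero ha0 hlc).symm
      by_contra hcon
      have h3 := mul_nonpos_of_nonpos_of_nonneg h1.le (not_lt.1 hcon)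
      have hb0 : 0 < orient p q b * orient p q b := by
        refine mul_self_pos.2 fun h0 => ?_
        simp [h0] at h1
      have h4 := mul_pos hac hb0
      have h5 := mul_nonneg (not_lt.1 hcon) (neg_nonneg.2 h1.le)
      have h6 : orient p q a * orient p q b * (orient p q b * orient p q c) =
        orient p q a * orient p q c * (orient p q b * orient p q b) := by ring
      linarith
    refine ⟨hbc, ?_⟩
    have := exit_signs' (la := orient p q b) (lb := orient p q a) (lc := orient p q c)
      (qa := orient a c q) (qb := orient c b q) (qc := orient b a q)
      (pa := orient a c p) (pb := orient c b p) (pc := orient b a p) (D := orient b a c)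
      (by linarith) hbc (by linarith) (by linarith) hq0 hp0 hbac.pos (by linarith) hout.symm
    rwa [orient_swap c b, orient_swap c b, neg_mul_neg] at this

/-- The neighbours of `p` in the graph `T`. -/
def nbrs (S : Finset Pt) (T : Finset (Sym2 Pt)) (p : Pt) : Finset Pt :=
  S.filter fun q => s(p, q) ∈ T

/-- The edges of `T` that together with `p` span an empty triangle. -/
def link (S : Finset Pt) (T : Finset (Sym2 Pt)) (p : Pt) : Finset (Sym2 Pt) :=
  T.filter fun e => ∃ a b, e = s(a, b) ∧ EmptyTri S T p a b

lemma IsPlaneGraph.card_link_le (hS : GenPos S) (hT : IsPlaneGraph S T) (p : Pt) :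
    (link S T p).card ≤ (nbrs S T p).card := by
  have h : ∀ e ∈ link S T p, ∃ a b, e = s(a, b) ∧ EmptyTri S T p a b :=
    fun e he => (Finset.mem_filter.1 he).2
  choose! f g hf using h
  refine Finset.card_le_card_of_injOn f ?_ ?_
  · intro e he
    have := (hf e he).2.mem₁
    simp only [nbrs, Finset.coe_filter, Set.mem_ofPred_eq]
    exact ⟨hT.right_mem this, this⟩
  · intro e he e' he' heq
    have h1 := hf e he
    have h2 := hf e' he'
    rw [← heq] at h2
    rw [h1.1, h2.1, h1.2.unique hS hT h2.2]

lemma exists_injective_functional (S : Finset Pt) :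
    ∃ t : ℝ, ∀ p ∈ S, ∀ q ∈ S, p ≠ q → p.1 + t * p.2 ≠ q.1 + t * q.2 := by
  obtain ⟨t, ht⟩ := ((S ×ˢ S).image
    (fun x : Pt × Pt => (x.2.1 - x.1.1) / (x.1.2 - x.2.2))).exists_notMem
  refine ⟨t, fun p hp q hq hpq h => ?_⟩
  by_cases h0 : p.2 - q.2 = 0
  · have e : p.2 = q.2 := by linarith
    rw [e] at h
    exact hpq (Prod.ext (by linarith) e)
  · refine ht (Finset.mem_image.2 ⟨(p, q), by simp [hp, hq], ?_⟩)
    rw [div_eq_iff h0]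
    linarith

lemma orient_plucker (o a b c : Pt) (t : ℝ) :
    (a.1 + t * a.2 - (o.1 + t * o.2)) * orient o b c +
      (b.1 + t * b.2 - (o.1 + t * o.2)) * orient o c a +
      (c.1 + t * c.2 - (o.1 + t * o.2)) * orient o a b = 0 := by
  simp only [orient]; ring

theorem IsTriangulation.card_le (hS : GenPos S) (hT : IsTriangulation S T) :
    T.card ≤ 3 * S.card := by
  obtain ⟨t, ht⟩ := exists_injective_functional S
  set h : Pt → ℝ := fun p => p.1 + t * p.2
  have ht' : ∀ p ∈ S, ∀ q ∈ S, p ≠ q → h p ≠ h q := ht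
  have pl : ∀ o a b c, (h a - h o) * orient o b c + (h b - h o) * orient o c a +
      (h c - h o) * orient o a b = 0 := fun o a b c => orient_plucker o a b c t
  have hP := hT.plane
  clear_value h
  set P0 : Pt → Pt → Prop := fun p q => h p < h q ∧ ∀ q', s(p, q') ∈ T → h p < h q' →
    orient p q q' ≤ 0 with hP0
  set P1 : Pt → Pt → Prop := fun p q => h p < h q ∧ ∃ c, EmptyTri S T p q c ∧ h q < h c with hP1
  set P2 : Pt → Pt → Pt → Prop := fun p q c => EmptyTri S T p q c ∧ h p < h c ∧ h c < h q with hP2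
  set T0 := T.filter fun e => ∃ p q, e = s(p, q) ∧ P0 p q with hT0
  set T1 := T.filter fun e => ∃ p q, e = s(p, q) ∧ P1 p q with hT1
  set T2 := T.filter fun e => ∃ p q c, e = s(p, q) ∧ P2 p q c with hT2
  have hcover : T ⊆ T0 ∪ T1 ∪ T2 := by
    intro e he
    have main : ∀ p q, s(p, q) ∈ T → h p < h q → s(p, q) ∈ T0 ∪ T1 ∪ T2 := by
      intro p q he hpq
      by_cases h0 : P0 p q
      · simp only [Finset.mem_union, hT0, Finset.mem_filter]
        exact Or.inl (Or.inl ⟨he, p, q, rfl, h0⟩)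
      · simp only [hP0, not_and, not_forall, not_le] at h0
        obtain ⟨q', hq', hpq', hpos⟩ := h0 hpq
        obtain ⟨c, hc⟩ := hT.exists_emptyTri hS he (hP.right_mem hq') hpos
        have h1 : orient p q' c ≤ 0 := by
          by_contra hcon
          exact hc.not_wedge hS hP hq' hpos (not_le.1 hcon)
        have hpc : h p < h c := by
          have h2 := pl p q c q'
          have h3 := hc.pos
          have e1 : orient p c q' = - orient p q' c := orient_swap_right _ _ _
          have e2 : orient p q' q = - orient p q q' := orient_swap_right _ _ _
          rw [e1, e2] at h2
          have h4 := mul_nonneg (sub_nonneg.2 hpq.le) (neg_nonneg.2 h1)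
          have h5 := mul_pos (sub_pos.2 hpq') h3
          have h6 : 0 < (h c - h p) * orient p q q' := by linarith
          exact sub_pos.1 (pos_of_mul_pos_left h6 hpos.le)
        have hcq : h q ≠ h c :=
          ht' q (hP.left_mem hc.mem₂) c (hP.right_mem hc.mem₂) hc.ne₂₃
        rcases lt_or_gt_of_ne hcq with hlt | hlt
        · simp only [Finset.mem_union, hT1, Finset.mem_filter]
          exact Or.inl (Or.inr ⟨he, p, q, rfl, hpq, c, hc, hlt⟩)
        · simp only [Finset.mem_union, hT2, Finset.mem_filter]
          exact Or.inr ⟨he, p, q, c, rfl, hc, hpc, hlt⟩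
    induction e using Sym2.ind with
    | _ p q =>
      rcases lt_or_gt_of_ne (ht' p (hP.left_mem he) q (hP.right_mem he) (hP.ne he)) with hlt | hlt
      · exact main p q he hlt
      · rw [Sym2.eq_swap]
        exact main q p (by rwa [Sym2.eq_swap]) hlt
  have card0 : T0.card ≤ S.card := by
    have hex : ∀ e ∈ T0, ∃ p q, e = s(p, q) ∧ P0 p q := fun e he => (Finset.mem_filter.1 he).2
    choose! f g hf using hex
    refine Finset.card_le_card_of_injOn f ?_ ?_
    · intro e he
      have h1 := (Finset.mem_filter.1 he).1
      rw [(hf e he).1] at h1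
      exact hP.left_mem h1
    · intro e he e' he' heq
      have m1 := (Finset.mem_filter.1 he).1
      have m2 := (Finset.mem_filter.1 he').1
      obtain ⟨k1, l1, l1'⟩ := hf e he
      obtain ⟨k2, l2, l2'⟩ := hf e' he'
      rw [k1] at m1
      rw [k2] at m2
      rw [← heq] at l2 l2' m2 k2
      rw [k1, k2]
      by_contra hne
      have hg : g e ≠ g e' := fun h => hne (by rw [h])
      have h1 := l1' _ m2 l2
      have h2 := l2' _ m1 l1
      rw [orient_swap_right] at h2
      exact hS.orient_ne_zero (hP.left_mem m1) (hP.right_mem m1) (hP.right_mem m2)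
        (hP.ne m1) (hP.ne m2) hg (by linarith)
  have card1 : T1.card ≤ S.card := by
    have hex : ∀ e ∈ T1, ∃ p q, e = s(p, q) ∧ P1 p q := fun e he => (Finset.mem_filter.1 he).2
    choose! f g hf using hex
    refine Finset.card_le_card_of_injOn g ?_ ?_
    · intro e he
      have h1 := (Finset.mem_filter.1 he).1
      rw [(hf e he).1] at h1
      exact hP.right_mem h1
    · have aux : ∀ p p' q c c', EmptyTri S T p q c → EmptyTri S T p' q c' → h p < h q →
          h p' < h q → h q < h c → h q < h c' → 0 < orient q p' p → False := by
        intro p p' q c c' hc hc' hp hp' hqc hqc' hpos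
        have hc1 := hc.rotate
        refine hc1.not_wedge hS hP (d := p') (by rw [Sym2.eq_swap]; exact hc'.mem₁) ?_ hpos
        have h1 := pl q c p' p
        have e1 : orient q p c = - orient q c p := orient_swap_right _ _ _
        rw [e1] at h1
        have h2 := mul_pos (sub_pos.2 hqc) hpos
        have h3 := mul_pos (sub_pos.2 hp') hc1.pos
        have h4 : 0 < (h q - h p) * orient q c p' := by linarith
        exact pos_of_mul_pos_right h4 (sub_nonneg.2 hp.le)
      intro e he e' he' heq
      obtain ⟨k1, l1, c, hc, hqc⟩ := hf e he
      obtain ⟨k2, l2, c', hc', hqc'⟩ := hf e' he'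
      rw [← heq] at k2 l2 hc' hqc'
      rw [k1, k2]
      by_contra hne
      have hfe : f e ≠ f e' := fun h => hne (by rw [h])
      have h0 := hS.orient_ne_zero (hP.right_mem hc.mem₁) (hP.left_mem hc.mem₁)
        (hP.left_mem hc'.mem₁) (hP.ne hc.mem₁).symm (hP.ne hc'.mem₁).symm hfe
      rcases lt_or_gt_of_ne h0 with h0 | h0
      · rw [orient_swap_right] at h0
        exact aux _ _ _ _ _ hc hc' l1 l2 hqc hqc' (by linarith)
      · exact aux _ _ _ _ _ hc' hc l2 l1 hqc' hqc h0
  have card2 : T2.card ≤ S.card := by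
    have hex : ∀ e ∈ T2, ∃ p q c, e = s(p, q) ∧ P2 p q c :=
      fun e he => (Finset.mem_filter.1 he).2
    choose! f g k hf using hex
    refine Finset.card_le_card_of_injOn k ?_ ?_
    · intro e he
      exact hP.left_mem (hf e he).2.1.mem₃
    · have aux : ∀ p q p' q' c, EmptyTri S T p q c → EmptyTri S T p' q' c → h p < h c →
          h c < h q → h p' < h c → h c < h q' → 0 < orient c p p' → False := by
        intro p q p' q' c hc hc' hp hq hp' hq' hpos
        have hc1 := hc.rotate.rotate
        refine hc1.not_wedge hS hP (d := p') hc'.mem₃ hpos ?_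
        have h1 := pl c p p' q
        have e1 : orient c q p = - orient c p q := orient_swap_right _ _ _
        rw [e1] at h1
        have h2 := mul_pos (sub_pos.2 hq) hpos
        have h3 := mul_pos (sub_pos.2 hp') hc1.pos
        have h4 : 0 < (h c - h p) * orient c p' q := by linarith
        exact pos_of_mul_pos_right h4 (sub_nonneg.2 hp.le)
      intro e he e' he' heq
      obtain ⟨k1, hc, l1, m1⟩ := hf e he
      obtain ⟨k2, hc', l2, m2⟩ := hf e' he'
      rw [← heq] at hc' l2 m2
      have hfe : f e = f e' := by
        by_contra hfe
        have h0 := hS.orient_ne_zero (hP.left_mem hc.mem₃) (hP.left_mem hc.mem₁)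
          (hP.left_mem hc'.mem₁) (hP.ne hc.mem₃) (hP.ne hc'.mem₃) hfe
        rcases lt_or_gt_of_ne h0 with h0 | h0
        · rw [orient_swap_right] at h0
          exact aux _ _ _ _ _ hc' hc l2 m2 l1 m1 (by linarith)
        · exact aux _ _ _ _ _ hc hc' l1 m1 l2 m2 h0
      rw [← hfe] at hc' k2
      rw [k1, k2, hc.rotate.rotate.unique hS hP hc'.rotate.rotate]
  have h1 := Finset.card_le_card hcover
  have h2 := Finset.card_union_le (T0 ∪ T1) T2
  have h3 := Finset.card_union_le T0 T1
  omega

/-- The points of `S` that `p` can be joined to without crossing an edge of `G`. -/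
def visible (S : Finset Pt) (p : Pt) (G : Finset (Sym2 Pt)) : Finset Pt :=
  S.filter fun q => q ≠ p ∧ IsPlaneGraph S (insert s(p, q) G)

/-- The graph `G` with all possible edges at `p` added. -/
def fillAt (S : Finset Pt) (p : Pt) (G : Finset (Sym2 Pt)) : Finset (Sym2 Pt) :=
  G ∪ (visible S p G).image fun q => s(p, q)

lemma mem_planeGraphs {G : Finset (Sym2 Pt)} : G ∈ planeGraphs S ↔ IsPlaneGraph S G := by
  simp only [planeGraphs, Finset.mem_filter, Finset.mem_powerset, and_iff_right_iff_imp]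
  exact fun hG e he => Finset.mem_sym2_iff.2 (hG.1 e he).2

lemma visible_anti (p : Pt) : Antitone (visible S p) := fun _ _ h _ hq => by
  simp only [visible, Finset.mem_filter] at hq ⊢
  exact ⟨hq.1, hq.2.1, hq.2.2.mono (Finset.insert_subset_insert _ h)⟩

lemma mem_visible_of_mem {G : Finset (Sym2 Pt)} (hG : IsPlaneGraph S G) {p q : Pt}
    (h : s(p, q) ∈ G) : q ∈ visible S p G := by
  simp only [visible, Finset.mem_filter]
  exact ⟨hG.right_mem h, (hG.ne h).symm, by rwa [Finset.insert_eq_of_mem h]⟩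

lemma filter_mem_fillAt {G : Finset (Sym2 Pt)} (hG : IsPlaneGraph S G) (p : Pt) :
    (fillAt S p G).filter (p ∈ ·) = (visible S p G).image fun q => s(p, q) := by
  ext e
  simp only [fillAt, Finset.mem_filter, Finset.mem_union]
  constructor
  · rintro ⟨he | he, hpe⟩
    · obtain ⟨q, rfl⟩ := hpe
      exact Finset.mem_image_of_mem _ (mem_visible_of_mem hG he)
    · exact he
  · intro he
    refine ⟨Or.inr he, ?_⟩
    obtain ⟨q, -, rfl⟩ := Finset.mem_image.1 he
    simp

lemma card_filter_mem_fillAt {G : Finset (Sym2 Pt)} (hG : IsPlaneGraph S G) (p : Pt) :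
    ((fillAt S p G).filter (p ∈ ·)).card = (visible S p G).card := by
  rw [filter_mem_fillAt hG]
  exact Finset.card_image_of_injective _ fun _ _ h => Sym2.congr_right.1 h

lemma filter_notMem_fillAt (p : Pt) (G : Finset (Sym2 Pt)) :
    (fillAt S p G).filter (p ∉ ·) = G.filter (p ∉ ·) := by
  ext e
  simp only [fillAt, Finset.mem_filter, Finset.mem_union, and_congr_left_iff, or_iff_left_iff_imp]
  intro hpe he
  obtain ⟨q, -, rfl⟩ := Finset.mem_image.1 he
  simp at hpe

lemma GenPos.not_edgesCross_of_common (hS : GenPos S) {p q r : Pt} (hp : p ∈ S) (hq : q ∈ S)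
    (hr : r ∈ S) (hpq : p ≠ q) (hpr : p ≠ r) (hne : s(p, q) ≠ s(p, r)) :
    ¬ EdgesCross s(p, q) s(p, r) := by
  rw [hS.edgesCross_iff_segCross hp hq hp hr hpq hpr hne]
  simp [SegCross]

lemma isPlaneGraph_fillAt (hS : GenPos S) {G : Finset (Sym2 Pt)} (hG : IsPlaneGraph S G) {p : Pt}
    (hp : p ∈ S) : IsPlaneGraph S (fillAt S p G) := by
  have hv : ∀ q ∈ visible S p G, q ∈ S ∧ p ≠ q ∧ IsPlaneGraph S (insert s(p, q) G) := by
    intro q hq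
    simp only [visible, Finset.mem_filter] at hq
    exact ⟨hq.1, hq.2.1.symm, hq.2.2⟩
  refine ⟨fun e he => ?_, fun e he f hf hef => ?_⟩
  · rcases Finset.mem_union.1 he with he | he
    · exact hG.1 e he
    · obtain ⟨q, hq, rfl⟩ := Finset.mem_image.1 he
      exact (hv q hq).2.2.1 _ (Finset.mem_insert_self _ _)
  · rcases Finset.mem_union.1 he with he | he <;> rcases Finset.mem_union.1 hf with hf | hf
    · exact hG.2 e he f hf hef
    · obtain ⟨q, hq, rfl⟩ := Finset.mem_image.1 hf
      exact (hv q hq).2.2.2 _ (Finset.mem_insert_of_mem he) _ (Finset.mem_insert_self _ _) hef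
    · obtain ⟨q, hq, rfl⟩ := Finset.mem_image.1 he
      exact (hv q hq).2.2.2 _ (Finset.mem_insert_self _ _) _ (Finset.mem_insert_of_mem hf) hef
    · obtain ⟨q, hq, rfl⟩ := Finset.mem_image.1 he
      obtain ⟨r, hr, rfl⟩ := Finset.mem_image.1 hf
      exact hS.not_edgesCross_of_common hp (hv q hq).1 (hv r hr).1 (hv q hq).2.1 (hv r hr).2.1 hef

lemma isXVing_fillAt (p : Pt) (G : Finset (Sym2 Pt)) : IsXVing S (fillAt S p G) p := by
  intro q hq hqp hne hpl
  refine hne (Finset.mem_union_right _ (Finset.mem_image_of_mem _ ?_))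
  simp only [visible, Finset.mem_filter]
  exact ⟨hq, hqp, hpl.mono (Finset.insert_subset_insert _ Finset.subset_union_left)⟩

/-- The weight `2 ^ (-k)`, where `k` is the number of points visible from `p`. -/
def wt (S : Finset Pt) (p : Pt) (G : Finset (Sym2 Pt)) : ℝ := (1 / 2) ^ (visible S p G).card

lemma wt_nonneg (p : Pt) (G : Finset (Sym2 Pt)) : 0 ≤ wt S p G := by
  unfold wt; positivity

lemma wt_mono (p : Pt) : Monotone (wt S p) := fun _ _ h =>
  pow_le_pow_of_le_one (by norm_num) (by norm_num) (Finset.card_le_card (visible_anti p h))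

lemma sum_wt_fiber_le (p : Pt) (H : Finset (Sym2 Pt)) :
    ∑ G ∈ planeGraphs S with fillAt S p G = H, wt S p G ≤ 1 := by
  set d := (H.filter (p ∈ ·)).card with hd
  have h1 : ∀ G ∈ (planeGraphs S).filter (fillAt S p · = H), wt S p G = (1 / 2) ^ d := by
    intro G hG
    obtain ⟨hpl, rfl⟩ := Finset.mem_filter.1 hG
    rw [wt, hd, card_filter_mem_fillAt (mem_planeGraphs.1 hpl)]
  have h2 : ((planeGraphs S).filter (fillAt S p · = H)).card ≤ 2 ^ d := by
    rw [hd, ← Finset.card_powerset]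
    refine Finset.card_le_card_of_injOn (fun G => G.filter (p ∈ ·)) ?_ ?_
    · intro G hG
      obtain ⟨-, rfl⟩ := Finset.mem_filter.1 hG
      exact Finset.mem_coe.2 (Finset.mem_powerset.2
        (Finset.filter_subset_filter _ Finset.subset_union_left))
    · intro G hG G' hG' h
      obtain ⟨-, hG⟩ := Finset.mem_filter.1 hG
      obtain ⟨-, hG'⟩ := Finset.mem_filter.1 hG'
      rw [← Finset.filter_union_filter_not_eq (p ∈ ·) G,
        ← Finset.filter_union_filter_not_eq (p ∈ ·) G', ← filter_notMem_fillAt (S := S),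
        ← filter_notMem_fillAt (S := S) p G', hG, hG']
      exact congrArg (· ∪ _) h
  rw [Finset.sum_congr rfl h1, Finset.sum_const, nsmul_eq_mul]
  calc _ ≤ ((2 ^ d : ℕ) : ℝ) * (1 / 2) ^ d := by gcongr
    _ = 1 := by
      push_cast
      rw [← mul_pow]
      norm_num

lemma sum_wt_le_card_isXVing (hS : GenPos S) {p : Pt} (hp : p ∈ S) :
    ∑ G ∈ planeGraphs S, wt S p G ≤ ((planeGraphs S).filter (IsXVing S · p)).card := by
  rw [← Finset.sum_fiberwise_of_maps_to (s := planeGraphs S)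
    (t := (planeGraphs S).filter (IsXVing S · p)) (g := fillAt S p)]
  · refine (Finset.sum_le_sum fun H _ => sum_wt_fiber_le p H).trans ?_
    simp
  · intro G hG
    exact Finset.mem_filter.2 ⟨mem_planeGraphs.2
      (isPlaneGraph_fillAt hS (mem_planeGraphs.1 hG) hp), isXVing_fillAt p G⟩

lemma not_segCross_of_mem_visible {G : Finset (Sym2 Pt)} {p q a b : Pt}
    (hq : q ∈ visible S p G) (h : s(a, b) ∈ G) : ¬ SegCross p q a b :=
  (Finset.mem_filter.1 hq).2.2.not_segCross (Finset.mem_insert_self _ _)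
    (Finset.mem_insert_of_mem h)

lemma IsTriangulation.exists_link_of_mem_visible (hS : GenPos S) (hT : IsTriangulation S T)
    {G : Finset (Sym2 Pt)} {p q : Pt} (hp : p ∈ S) (hq : q ∈ visible S p G)
    (hqn : q ∉ nbrs S T p) : ∃ a b, EmptyTri S T p a b ∧ SegCross p q a b ∧ s(a, b) ∉ G := by
  have hq' := (Finset.mem_filter.1 hq)
  obtain ⟨a, b, h1, h2⟩ := hT.exists_link_segCross hS hp hq'.1 hq'.2.1.symm
    (fun h => hqn (Finset.mem_filter.2 ⟨hq'.1, h⟩))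
  exact ⟨a, b, h1, h2, fun h => not_segCross_of_mem_visible hq h h2⟩

lemma EmptyTri.mem_link {p a b : Pt} (h : EmptyTri S T p a b) : s(a, b) ∈ link S T p :=
  Finset.mem_filter.2 ⟨h.mem₂, a, b, rfl, h⟩

lemma IsTriangulation.visible_subset_nbrs (hS : GenPos S) (hT : IsTriangulation S T)
    {G : Finset (Sym2 Pt)} {p : Pt} (hp : p ∈ S) (h : link S T p ⊆ G) :
    visible S p G ⊆ nbrs S T p := by
  intro q hq
  by_contra hqn
  obtain ⟨a, b, h1, -, h3⟩ := hT.exists_link_of_mem_visible hS hp hq hqn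
  exact h3 (h h1.mem_link)

lemma IsTriangulation.exists_opposite (hS : GenPos S) (hT : IsTriangulation S T)
    {p : Pt} (hp : p ∈ S) {e : Sym2 Pt} (he : e ∈ link S T p) :
    ∃ B ⊆ T, e ∉ B ∧ B.card ≤ 2 ∧ ∃ c, ∀ G, (link S T p).erase e ∪ B ⊆ G →
      visible S p G ⊆ insert c (nbrs S T p) := by
  obtain ⟨-, a, b, rfl, hab⟩ := Finset.mem_filter.1 he
  have hbaT : s(b, a) ∈ T := by rw [Sym2.eq_swap]; exact hab.mem₂
  have key : ∀ G, (link S T p).erase s(a, b) ⊆ G → ∀ q ∈ visible S p G, q ∉ nbrs S T p →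
      SegCross p q a b := by
    intro G hG q hq hqn
    obtain ⟨a', b', h1, h2, h3⟩ := hT.exists_link_of_mem_visible hS hp hq hqn
    have heq : s(a', b') = s(a, b) := by
      by_contra hne
      exact h3 (hG (Finset.mem_erase.2 ⟨hne, h1.mem_link⟩))
    rcases Sym2.eq_iff.1 heq with ⟨rfl, rfl⟩ | ⟨rfl, rfl⟩
    · exact h2
    · exact h2.swap_right
  by_cases hc : ∃ c, EmptyTri S T b a c
  · obtain ⟨c, hc⟩ := hc
    have hacT := hc.mem₂
    have hcbT := hc.mem₃
    refine ⟨{s(a, c), s(c, b)}, ?_, ?_, Finset.card_le_two, c, fun G hG q hq => ?_⟩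
    · intro f hf
      rcases Finset.mem_insert.1 hf with rfl | hf
      · exact hacT
      · rwa [Finset.mem_singleton.1 hf]
    · have h1 := hT.plane.ne hacT
      have h2 := hT.plane.ne hcbT
      have h3 := hT.plane.ne hbaT
      simp only [Finset.mem_insert, Finset.mem_singleton, Sym2.eq_iff]
      rintro ((⟨-, h⟩ | ⟨h, -⟩) | (⟨h, -⟩ | ⟨h, -⟩))
      · exact h2 h.symm
      · exact h1 h
      · exact h1 h
      · exact h3 h.symm
    · by_contra hcon
      rw [Finset.mem_insert, not_or] at hcon
      have hX := key G (Finset.union_subset_left hG) q hq hcon.2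
      have hB := Finset.union_subset_right hG
      rcases hT.plane.segCross_opposite hS (Finset.mem_filter.1 hq).1 hab hX hc hcon.1 with h | h
      · exact not_segCross_of_mem_visible hq (hB (by simp)) h.swap_right
      · exact not_segCross_of_mem_visible hq (hB (by simp)) h
  · refine ⟨∅, by simp, by simp, by simp, p, fun G hG q hq => ?_⟩
    by_contra hcon
    rw [Finset.mem_insert, not_or] at hcon
    have hX := key G (Finset.union_subset_left hG) q hq hcon.2
    refine hc (hT.exists_emptyTri hS hbaT (Finset.mem_filter.1 hq).1 ?_)
    have h2 := hX.2
    have hp0 : 0 < orient a b p := by rw [← orient_rotate]; exact hab.pos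
    rw [mul_comm] at h2
    rw [orient_swap]
    by_contra hcon2
    have := mul_nonneg (show 0 ≤ orient a b q by linarith) hp0.le
    linarith

lemma le_wt_of_card_visible_le {G : Finset (Sym2 Pt)} {p : Pt} {k : ℕ}
    (h : (visible S p G).card ≤ k) : (1 / 2 : ℝ) ^ k ≤ wt S p G :=
  pow_le_pow_of_le_one (by norm_num) (by norm_num) h

lemma card_Icc_finset_real {α : Type*} [DecidableEq α] {s t : Finset α} (h : s ⊆ t) {n : ℕ}
    (hn : s.card ≤ n) : (2 : ℝ) ^ t.card * (1 / 2) ^ n ≤ (Finset.Icc s t).card := by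
  rw [Finset.card_Icc_finset h]
  push_cast
  have e : (2 : ℝ) ^ t.card = 2 ^ (t.card - s.card) * 2 ^ s.card := by
    rw [← pow_add, Nat.sub_add_cancel (Finset.card_le_card h)]
  calc (2 : ℝ) ^ t.card * (1 / 2) ^ n ≤ 2 ^ t.card * (1 / 2) ^ s.card :=
        mul_le_mul_of_nonneg_left
          (pow_le_pow_of_le_one (by norm_num) (by norm_num) hn) (by positivity)
    _ = 2 ^ (t.card - s.card) := by
        rw [e, mul_assoc, ← mul_pow]
        norm_num

lemma antitone_half_pow_mul : Antitone fun n : ℕ => (1 / 2 : ℝ) ^ n * (1 + n / 8) := by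
  refine antitone_nat_of_succ_le fun n => ?_
  have h : (0 : ℝ) < (1 / 2) ^ n := by positivity
  have hn : (0 : ℝ) ≤ n := n.cast_nonneg
  push_cast
  rw [pow_succ, mul_assoc]
  refine mul_le_mul_of_nonneg_left ?_ h.le
  linarith

lemma IsTriangulation.le_sum_wt (hS : GenPos S) (hT : IsTriangulation S T) {p : Pt}
    (hp : p ∈ S) : (2 : ℝ) ^ T.card *
      ((1 / 4) ^ (nbrs S T p).card * (1 + (nbrs S T p).card / 8)) ≤
      ∑ G ∈ T.powerset, wt S p G := by
  set d := (nbrs S T p).card with hd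
  set L := link S T p with hL
  have hLT : L ⊆ T := Finset.filter_subset _ _
  choose! B hBT heB hB2 c hBc using fun e (he : e ∈ L) => hT.exists_opposite hS hp he
  set E : Sym2 Pt → Finset (Finset (Sym2 Pt)) :=
    fun e => Finset.Icc (L.erase e ∪ B e) (T.erase e) with hE
  have hdisjE : (L : Set (Sym2 Pt)).PairwiseDisjoint E := by
    intro e he e' he' hne
    refine Finset.disjoint_left.2 fun G hG hG' => ?_
    have h1 := (Finset.mem_Icc.1 hG).2
    have h2 := (Finset.mem_Icc.1 hG').1
    exact Finset.notMem_erase e T (h1 (h2 (Finset.mem_union_left _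
      (Finset.mem_erase.2 ⟨hne, he⟩))))
  have hdisj0 : Disjoint (Finset.Icc L T) (L.biUnion E) := by
    refine Finset.disjoint_left.2 fun G hG hG' => ?_
    obtain ⟨e, he, hGe⟩ := Finset.mem_biUnion.1 hG'
    exact Finset.notMem_erase e T ((Finset.mem_Icc.1 hGe).2 ((Finset.mem_Icc.1 hG).1 he))
  have hsub : Finset.Icc L T ∪ L.biUnion E ⊆ T.powerset := by
    intro G hG
    rw [Finset.mem_powerset]
    rcases Finset.mem_union.1 hG with hG | hG
    · exact (Finset.mem_Icc.1 hG).2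
    · obtain ⟨e, -, hGe⟩ := Finset.mem_biUnion.1 hG
      exact (Finset.mem_Icc.1 hGe).2.trans (Finset.erase_subset _ _)
  have h0 : (2 : ℝ) ^ T.card * (1 / 2) ^ L.card * (1 / 2) ^ d ≤
      ∑ G ∈ Finset.Icc L T, wt S p G := by
    calc _ ≤ ((Finset.Icc L T).card : ℝ) * (1 / 2) ^ d := by
          gcongr
          exact card_Icc_finset_real hLT le_rfl
      _ = ∑ G ∈ Finset.Icc L T, (1 / 2 : ℝ) ^ d := by rw [Finset.sum_const, nsmul_eq_mul]
      _ ≤ _ := Finset.sum_le_sum fun G hG => le_wt_of_card_visible_le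
          (Finset.card_le_card (hT.visible_subset_nbrs hS hp (Finset.mem_Icc.1 hG).1))
  have h1 : ∀ e ∈ L, (2 : ℝ) ^ T.card * (1 / 2) ^ L.card * (1 / 2) ^ d * (1 / 8) ≤
      ∑ G ∈ E e, wt S p G := by
    intro e he
    have hcT : (T.erase e).card + 1 = T.card := Finset.card_erase_add_one (hLT he)
    have hcL : (L.erase e).card + 1 = L.card := Finset.card_erase_add_one he
    have hA : (L.erase e ∪ B e).card ≤ L.card + 1 := by
      have := Finset.card_union_le (L.erase e) (B e)
      have := hB2 e he
      omega
    have hAT : L.erase e ∪ B e ⊆ T.erase e :=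
      Finset.union_subset (Finset.erase_subset_erase _ hLT)
        (Finset.subset_erase.2 ⟨hBT e he, heB e he⟩)
    calc _ = (2 : ℝ) ^ (T.erase e).card * (1 / 2) ^ (L.card + 1) * (1 / 2) ^ (d + 1) := by
          rw [← hcT]
          ring
      _ ≤ ((E e).card : ℝ) * (1 / 2) ^ (d + 1) := by
          gcongr
          exact card_Icc_finset_real hAT hA
      _ = ∑ G ∈ E e, (1 / 2 : ℝ) ^ (d + 1) := by rw [Finset.sum_const, nsmul_eq_mul]
      _ ≤ _ := Finset.sum_le_sum fun G hG => le_wt_of_card_visible_le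
          ((Finset.card_le_card (hBc e he G (Finset.mem_Icc.1 hG).1)).trans
            (Finset.card_insert_le _ _))
  have hLd : (1 / 2 : ℝ) ^ d * (1 + d / 8) ≤ (1 / 2) ^ L.card * (1 + L.card / 8) :=
    antitone_half_pow_mul (hT.plane.card_link_le hS p)
  calc (2 : ℝ) ^ T.card * ((1 / 4) ^ d * (1 + d / 8))
      = 2 ^ T.card * (1 / 2) ^ d * ((1 / 2) ^ d * (1 + d / 8)) := by
        rw [show (1 / 4 : ℝ) = 1 / 2 * (1 / 2) by norm_num, mul_pow]
        ring
    _ ≤ 2 ^ T.card * (1 / 2) ^ d * ((1 / 2) ^ L.card * (1 + L.card / 8)) := by gcongr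
    _ = (2 : ℝ) ^ T.card * (1 / 2) ^ L.card * (1 / 2) ^ d +
        ∑ e ∈ L, (2 : ℝ) ^ T.card * (1 / 2) ^ L.card * (1 / 2) ^ d * (1 / 8) := by
        rw [Finset.sum_const, nsmul_eq_mul]
        ring
    _ ≤ ∑ G ∈ Finset.Icc L T, wt S p G + ∑ e ∈ L, ∑ G ∈ E e, wt S p G :=
        add_le_add h0 (Finset.sum_le_sum h1)
    _ = ∑ G ∈ Finset.Icc L T ∪ L.biUnion E, wt S p G := by
        rw [Finset.sum_union hdisj0, Finset.sum_biUnion hdisjE]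
    _ ≤ _ := Finset.sum_le_sum_of_subset_of_nonneg hsub fun G _ _ => wt_nonneg p G

lemma tangent_le (d : ℕ) :
    13.75 / 4096 - 2 / 4096 * (d : ℝ) ≤ (1 / 4) ^ d * (1 + d / 8) := by
  by_cases h : 7 ≤ d
  · have h' : (7 : ℝ) ≤ d := by exact_mod_cast h
    have : (0 : ℝ) ≤ (1 / 4) ^ d * (1 + d / 8) := by positivity
    linarith
  · have : d < 7 := by omega
    interval_cases d <;> norm_num

lemma card_nbrs_le (p : Pt) :
    (nbrs S T p).card ≤ (T.filter (p ∈ ·)).card := by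
  refine Finset.card_le_card_of_injOn (fun q => s(p, q)) ?_ ?_
  · intro q hq
    exact Finset.mem_coe.2 (Finset.mem_filter.2 ⟨(Finset.mem_filter.1 hq).2, by simp⟩)
  · exact fun _ _ _ _ h => Sym2.congr_right.1 h

lemma sum_card_nbrs_le :
    ∑ p ∈ S, (nbrs S T p).card ≤ 2 * T.card := by
  calc _ ≤ ∑ p ∈ S, (T.filter (p ∈ ·)).card := Finset.sum_le_sum fun p _ => card_nbrs_le p
    _ = ∑ e ∈ T, (S.filter (· ∈ e)).card :=
        Finset.sum_card_bipartiteAbove_eq_sum_card_bipartiteBelow _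
    _ ≤ ∑ e ∈ T, 2 := by
        refine Finset.sum_le_sum fun e _ => ?_
        induction e using Sym2.ind with
        | _ a b =>
          refine (Finset.card_le_card (t := {a, b}) fun x hx => ?_).trans Finset.card_le_two
          simpa using (Finset.mem_filter.1 hx).2
    _ = 2 * T.card := by simp [mul_comm]

lemma IsTriangulation.le_sum_sum_wt (hS : GenPos S) (hT : IsTriangulation S T) :
    (2 : ℝ) ^ T.card * (S.card / 3207.42) ≤ ∑ G ∈ T.powerset, ∑ p ∈ S, wt S p G := by
  have hdeg : (∑ p ∈ S, ((nbrs S T p).card : ℝ)) ≤ 6 * S.card := by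
    have h1 := sum_card_nbrs_le (S := S) (T := T)
    have h2 := hT.card_le hS
    exact_mod_cast (show ∑ p ∈ S, (nbrs S T p).card ≤ 6 * S.card by omega)
  have hN : (0 : ℝ) ≤ S.card := Nat.cast_nonneg _
  rw [Finset.sum_comm]
  calc (2 : ℝ) ^ T.card * (S.card / 3207.42)
      ≤ 2 ^ T.card * ∑ p ∈ S, (13.75 / 4096 - 2 / 4096 * ((nbrs S T p).card : ℝ)) := by
        gcongr
        rw [Finset.sum_sub_distrib, ← Finset.mul_sum, Finset.sum_const, nsmul_eq_mul]
        rw [div_le_iff₀ (by norm_num)]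
        linarith
    _ ≤ 2 ^ T.card * ∑ p ∈ S,
          (1 / 4 : ℝ) ^ (nbrs S T p).card * (1 + (nbrs S T p).card / 8) := by
        gcongr
        exact tangent_le _
    _ = ∑ p ∈ S, (2 : ℝ) ^ T.card *
          ((1 / 4) ^ (nbrs S T p).card * (1 + (nbrs S T p).card / 8)) := Finset.mul_sum ..
    _ ≤ _ := Finset.sum_le_sum fun p hp => hT.le_sum_wt hS hp

lemma sum_mul_sum_le_of_monotoneOn {α : Type*} [DecidableEq α] (T : Finset α)
    {f g : Finset α → ℝ} (hf₀ : 0 ≤ f) (hg₀ : 0 ≤ g)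
    (hf : ∀ A B, A ⊆ B → B ⊆ T → f A ≤ f B) (hg : ∀ A B, A ⊆ B → B ⊆ T → g A ≤ g B) :
    (∑ A ∈ T.powerset, f A) * ∑ A ∈ T.powerset, g A ≤
      2 ^ T.card * ∑ A ∈ T.powerset, f A * g A := by
  have h := T.four_functions_theorem (f₁ := f) (f₂ := g) (f₃ := 1) (f₄ := fun A => f A * g A)
    hf₀ hg₀ zero_le_one (fun A => mul_nonneg (hf₀ A) (hg₀ A)) (fun A hA B hB => by
      have hAB := Finset.union_subset hA hB
      rw [Pi.one_apply, one_mul]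
      exact mul_le_mul (hf _ _ Finset.subset_union_left hAB)
        (hg _ _ Finset.subset_union_right hAB) (hg₀ _) (hf₀ _))
    (Finset.Subset.refl T.powerset) (Finset.Subset.refl T.powerset)
  simpa using h

/-- The triangulations of `S`. -/
def triangulations (S : Finset Pt) : Finset (Finset (Sym2 Pt)) :=
  (planeGraphs S).filter (IsTriangulation S)

lemma mem_triangulations : T ∈ triangulations S ↔ IsTriangulation S T := by
  simp only [triangulations, Finset.mem_filter, mem_planeGraphs, and_iff_right_iff_imp]
  exact fun h => h.plane

lemma IsPlaneGraph.exists_triangulation {G : Finset (Sym2 Pt)} (hG : IsPlaneGraph S G) :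
    ∃ T ∈ triangulations S, G ⊆ T := by
  obtain ⟨T, hGT, hT⟩ := (planeGraphs S).exists_le_maximal (mem_planeGraphs.2 hG)
  refine ⟨T, mem_triangulations.2 ⟨mem_planeGraphs.1 hT.1, fun p _ q _ _ hne hpl => hne ?_⟩, hGT⟩
  exact hT.2 (mem_planeGraphs.2 hpl) (Finset.subset_insert _ _) (Finset.mem_insert_self _ _)

/-- The reciprocal of the number of triangulations containing `G`. -/
def shareWt (S : Finset Pt) (G : Finset (Sym2 Pt)) : ℝ :=
  (((triangulations S).filter (G ⊆ ·)).card : ℝ)⁻¹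

lemma shareWt_mono {G H : Finset (Sym2 Pt)} (hT : T ∈ triangulations S) (hGH : G ⊆ H)
    (hHT : H ⊆ T) : shareWt S G ≤ shareWt S H := by
  refine inv_anti₀ ?_ ?_
  · exact_mod_cast Finset.card_pos.2 ⟨T, Finset.mem_filter.2 ⟨hT, hHT⟩⟩
  · exact_mod_cast Finset.card_le_card fun U hU =>
      Finset.mem_filter.2 ⟨(Finset.mem_filter.1 hU).1, hGH.trans (Finset.mem_filter.1 hU).2⟩

lemma sum_planeGraphs_eq (f : Finset (Sym2 Pt) → ℝ) :
    ∑ G ∈ planeGraphs S, f G =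
      ∑ T ∈ triangulations S, ∑ G ∈ T.powerset, shareWt S G * f G := by
  have h : ∀ T ∈ triangulations S, ∑ G ∈ T.powerset, shareWt S G * f G =
      ∑ G ∈ planeGraphs S, if G ⊆ T then shareWt S G * f G else 0 := by
    intro T hT
    rw [← Finset.sum_filter]
    refine Finset.sum_congr ?_ fun _ _ => rfl
    ext G
    simp only [Finset.mem_powerset, Finset.mem_filter, mem_planeGraphs, iff_and_self]
    exact fun h => (mem_triangulations.1 hT).plane.mono h
  rw [Finset.sum_congr rfl h, Finset.sum_comm]
  refine Finset.sum_congr rfl fun G hG => ?_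
  obtain ⟨T, hT, hGT⟩ := (mem_planeGraphs.1 hG).exists_triangulation
  have h0 : (((triangulations S).filter (G ⊆ ·)).card : ℝ) ≠ 0 := by
    exact_mod_cast (Finset.card_pos.2 ⟨T, Finset.mem_filter.2 ⟨hT, hGT⟩⟩).ne'
  rw [← Finset.sum_filter, Finset.sum_const, nsmul_eq_mul, shareWt, mul_inv_cancel_left₀ h0]

lemma le_sum_planeGraphs_wt (hS : GenPos S) :
    (planeGraphs S).card * ((S.card : ℝ) / 3207.42) ≤
      ∑ G ∈ planeGraphs S, ∑ p ∈ S, wt S p G := by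
  have h1 : ((planeGraphs S).card : ℝ) * (S.card / 3207.42) =
      ∑ G ∈ planeGraphs S, ((S.card : ℝ) / 3207.42) := by rw [Finset.sum_const, nsmul_eq_mul]
  rw [h1, sum_planeGraphs_eq, sum_planeGraphs_eq]
  refine Finset.sum_le_sum fun T hT => ?_
  have hw0 : ∀ G, 0 ≤ shareWt S G := fun G => inv_nonneg.2 (Nat.cast_nonneg _)
  have h2 := sum_mul_sum_le_of_monotoneOn T (f := shareWt S) (g := fun G => ∑ p ∈ S, wt S p G)
    hw0 (fun G => Finset.sum_nonneg fun p _ => wt_nonneg p G)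
    (fun A B hAB hB => shareWt_mono hT hAB hB)
    (fun A B hAB _ => Finset.sum_le_sum fun p _ => wt_mono p hAB)
  have h3 := (mem_triangulations.1 hT).le_sum_sum_wt hS
  have h4 : (0 : ℝ) < 2 ^ T.card := by positivity
  refine le_of_mul_le_mul_left ?_ h4
  refine le_trans ?_ h2
  rw [← Finset.sum_mul, mul_left_comm]
  exact mul_le_mul_of_nonneg_left h3 (Finset.sum_nonneg fun G _ => hw0 G)

lemma sum_vx_eq : ∑ G ∈ planeGraphs S, (vx S G : ℝ) =
    ∑ p ∈ S, (((planeGraphs S).filter (IsXVing S · p)).card : ℝ) := by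
  simp only [vx]
  exact_mod_cast Finset.sum_card_bipartiteAbove_eq_sum_card_bipartiteBelow
    (s := planeGraphs S) (t := S) (IsXVing S)

end Triangulation

/-- Lemma 2.4. For every set `S` of `N` points in general
position, `ĥv_x(S) ≥ N / 3207.42`. -/
theorem stmt3 (S : Finset Pt) (hgp : GenPos S) :
    (S.card : ℝ) / 3207.42 ≤ hvx S := by
  have hne : (planeGraphs S).Nonempty :=
    ⟨∅, mem_planeGraphs.2 ⟨by simp, by simp⟩⟩
  rw [hvx, le_div_iff₀ (by exact_mod_cast hne.card_pos), mul_comm, sum_vx_eq]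
  refine (le_sum_planeGraphs_wt hgp).trans ?_
  rw [Finset.sum_comm]
  exact Finset.sum_le_sum fun p hp => sum_wt_le_card_isXVing hgp hp
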